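/- arXiv:math/9610209 — 3 statements merged into one kernel-verified Lean document; each statement's English description precedes it below -/
import Mathlib

section
/- Let X be a real Banach space and W a bounded subset of X. Then W is not relatively weakly compact if and only if there exists a sequence (x_j) of elements of W which is a wide-(s) sequence. -/
open Finset Filter Metric NormedSpace

noncomputable section

universe u

variable {X Y : Type*} [NormedAddCommGroup X] [NormedSpace ℝ X]
  [NormedAddCommGroup Y] [NormedSpace ℝ Y]

/-- `b` is a `lam`-basic sequence: for all scalars `c` and all `k ≤ n`,
`‖∑_{j<k} c_j b_j‖ ≤ lam * ‖∑_{j<n} c_j b_j‖`. -/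
def IsBasicWith (lam : ℝ) (b : ℕ → X) : Prop :=
  ∀ (c : ℕ → ℝ) (k n : ℕ), k ≤ n →
    ‖∑ j ∈ Finset.range k, c j • b j‖ ≤ lam * ‖∑ j ∈ Finset.range n, c j • b j‖

/-- `b` is a `lam`-wide-(s) sequence: it is `2lam`-basic, `‖b j‖ ≤ lam` for all `j`,
and `|∑_{k≤j<n} c_j| ≤ lam * ‖∑_{j<n} c_j b_j‖` for all scalars and `k ≤ n`. -/
def IsWideSWith (lam : ℝ) (b : ℕ → X) : Prop :=
  IsBasicWith (2 * lam) b ∧ (∀ j, ‖b j‖ ≤ lam) ∧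
    ∀ (c : ℕ → ℝ) (k n : ℕ), k ≤ n →
      |∑ j ∈ Finset.Ico k n, c j| ≤ lam * ‖∑ j ∈ Finset.range n, c j • b j‖

/-- `b` is a wide-(s) sequence: `lam`-wide-(s) for some `lam ≥ 1`. -/
def IsWideS (b : ℕ → X) : Prop := ∃ lam, 1 ≤ lam ∧ IsWideSWith lam b

/-- `W` is relatively weakly compact: its closure in the weak topology is weakly compact. -/
def RelWeaklyCompact (W : Set X) : Prop :=
  IsCompact (closure (show Set (WeakSpace ℝ X) from W))

open Topology

lemma aux_sphere {Z : Type*} [NormedAddCommGroup Z] [NormedSpace ℝ Z] (V : Submodule ℝ Z)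
    (v : Z) (hv : v ∈ V) (h0 : v ≠ 0) :
    (‖v‖⁻¹ • (⟨v, hv⟩ : V)) ∈ Metric.sphere (0 : V) 1 := by
  rw [mem_sphere_zero_iff_norm, norm_smul, norm_inv, norm_norm]
  exact inv_mul_cancel₀ (norm_pos_iff.2 h0).ne'

lemma aux_norming {E : Type*} [NormedAddCommGroup E] [NormedSpace ℝ E]
    (V : Submodule ℝ (StrongDual ℝ E)) [FiniteDimensional ℝ V] :
    ∃ F : Finset E, (∀ f ∈ F, ‖f‖ ≤ 1) ∧ ∀ v ∈ V, ∃ f ∈ F, ‖v‖ ≤ 2 * |v f| := by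
  classical
  have hc : IsCompact (Metric.sphere (0 : V) 1) := isCompact_sphere _ _
  let U : Metric.closedBall (0 : E) 1 → Set V := fun f => {v | 1 / 2 < |(v : StrongDual ℝ E) f|}
  have hU : ∀ f, IsOpen (U f) := by
    intro f
    refine isOpen_lt continuous_const (continuous_abs.comp ?_)
    exact (ContinuousLinearMap.apply ℝ ℝ (f : E)).continuous.comp continuous_subtype_val
  have hcov : Metric.sphere (0 : V) 1 ⊆ ⋃ f, U f := by
    intro v hv
    have hv1 : ‖(v : StrongDual ℝ E)‖ = 1 := mem_sphere_zero_iff_norm.1 hv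
    by_contra hcon
    have h : ∀ f : E, ‖f‖ ≤ 1 → |(v : StrongDual ℝ E) f| ≤ 1 / 2 := by
      intro f hf
      by_contra hh
      apply hcon
      rw [Set.mem_iUnion]
      exact ⟨⟨f, by simpa using hf⟩, not_le.1 hh⟩
    have : ‖(v : StrongDual ℝ E)‖ ≤ 1 / 2 := by
      refine ContinuousLinearMap.opNorm_le_of_unit_norm (by norm_num) ?_
      intro x hx
      exact h x hx.le
    linarith
  obtain ⟨t, ht⟩ := hc.elim_finite_subcover U hU hcov
  refine ⟨insert 0 (t.image Subtype.val), ?_, ?_⟩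
  · intro f hf
    rcases Finset.mem_insert.1 hf with rfl | hf
    · simp
    · obtain ⟨g, _, rfl⟩ := Finset.mem_image.1 hf
      exact mem_closedBall_zero_iff.1 g.2
  · intro v hv
    by_cases h0 : v = 0
    · exact ⟨0, by simp, by simp [h0]⟩
    have hn : 0 < ‖v‖ := norm_pos_iff.2 h0
    have hm : (‖v‖⁻¹ • (⟨v, hv⟩ : V)) ∈ Metric.sphere (0 : V) 1 := by
      exact aux_sphere V v hv h0
    obtain ⟨f, hf, hfU⟩ := Set.mem_iUnion₂.1 (ht hm)
    refine ⟨f, Finset.mem_insert_of_mem (Finset.mem_image_of_mem _ hf), ?_⟩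
    have h2 : 1 / 2 < |‖v‖⁻¹ * v f| := hfU
    rw [abs_mul, abs_of_pos (inv_pos.2 hn), inv_mul_eq_div, lt_div_iff₀ hn] at h2
    linarith

lemma aux_seq {A : Type*} [DecidableEq A] (Q : ℕ → Finset A → A → Prop)
    (h : ∀ n S, ∃ y, Q n S y) :
    ∃ x : ℕ → A, ∀ n, Q n ((Finset.range n).image x) (x n) := by
  choose g hg using h
  let x : ℕ → A := fun n => Nat.strongRec
    (fun n ih => g n ((Finset.univ : Finset (Fin n)).image fun i => ih i.1 i.2)) n
  refine ⟨x, fun n => ?_⟩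
  have hx : x n = g n ((Finset.range n).image x) := by
    have : x n = g n ((Finset.univ : Finset (Fin n)).image fun i => x i.1) := by
      simp only [x]
      rw [Nat.strongRec]
    rw [this]
    congr 1
    ext a
    simp only [Finset.mem_image, Finset.mem_univ, true_and, Finset.mem_range]
    constructor
    · rintro ⟨i, rfl⟩; exact ⟨i.1, i.2, rfl⟩
    · rintro ⟨i, hi, rfl⟩; exact ⟨⟨i, hi⟩, rfl⟩
  rw [hx]
  exact hg _ _

lemma aux_helly {E : Type*} [NormedAddCommGroup E] [NormedSpace ℝ E] (b : ℕ → E) (a : ℕ → ℝ)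
    (lam : ℝ) (hlam : 0 ≤ lam) (h : ∀ (c : ℕ → ℝ) (n : ℕ), |∑ j ∈ Finset.range n, c j * a j| ≤
      lam * ‖∑ j ∈ Finset.range n, c j • b j‖) :
    ∃ f : StrongDual ℝ E, ‖f‖ ≤ lam ∧ ∀ j, f (b j) = a j := by
  let T : (ℕ →₀ ℝ) →ₗ[ℝ] E := Finsupp.linearCombination ℝ b
  let A : (ℕ →₀ ℝ) →ₗ[ℝ] ℝ := Finsupp.linearCombination ℝ a
  have key : ∀ c, |A c| ≤ lam * ‖T c‖ := by
    intro c
    obtain ⟨n, hn⟩ := c.support.exists_nat_subset_range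
    have := h c n
    have h1 : A c = ∑ j ∈ Finset.range n, c j * a j := by
      simp only [A, Finsupp.linearCombination_apply]
      exact Finsupp.sum_of_support_subset _ hn _ (by simp)
    have h2 : T c = ∑ j ∈ Finset.range n, c j • b j := by
      simp only [T, Finsupp.linearCombination_apply]
      exact Finsupp.sum_of_support_subset _ hn _ (by simp)
    rw [h1, h2]; exact this
  have hker : T.rangeRestrict.ker ≤ A.ker := by
    intro c hc
    have hc' : T c = 0 := by simpa [LinearMap.ker_rangeRestrict] using hc
    have := key c
    rw [hc'] at this
    simpa using this
  obtain ⟨g, hg⟩ : ∃ g : T.range →ₗ[ℝ] ℝ, g ∘ₗ T.rangeRestrict = A :=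
by
    obtain ⟨r, hr⟩ := T.rangeRestrict.exists_rightInverse_of_surjective T.range_rangeRestrict
    refine ⟨A ∘ₗ r, LinearMap.ext fun c => ?_⟩
    have h1 : r (T.rangeRestrict c) - c ∈ T.rangeRestrict.ker := by
      rw [LinearMap.mem_ker, map_sub, sub_eq_zero]
      exact LinearMap.congr_fun hr (T.rangeRestrict c)
    have h2 := hker h1
    rw [LinearMap.mem_ker, map_sub, sub_eq_zero] at h2
    exact h2
  have hgb : ∀ v, ‖g v‖ ≤ lam * ‖v‖ := by
    rintro ⟨_, c, rfl⟩
    have := key c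
    rw [← hg] at this
    exact this
  obtain ⟨f, hf, hfn⟩ := _root_.exists_extension_norm_eq T.range (g.mkContinuous lam hgb)
  refine ⟨f, hfn.le.trans (LinearMap.mkContinuous_norm_le _ hlam _), fun j => ?_⟩
  have h1 := hf (T.rangeRestrict (Finsupp.single j 1))
  have h2 : g (T.rangeRestrict (Finsupp.single j 1)) = A (Finsupp.single j 1) := by
    rw [← hg]; rfl
  simp only [LinearMap.mkContinuous_apply, h2] at h1
  simpa [T, A] using h1


lemma aux_contra {E : Type*} [NormedAddCommGroup E] [NormedSpace ℝ E] (f : StrongDual ℝ E)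
    (p y : E) (hp : f p = 1) (hy : f y = 0) (lam : ℝ) (hlam : 1 ≤ lam) (hf : ‖f‖ ≤ lam)
    (hd : dist p y < 1 / (2 * lam)) : False := by
  have h1 := f.le_opNorm (p - y)
  rw [map_sub, hp, hy, sub_zero, norm_one, ← dist_eq_norm] at h1
  have h2 : ‖f‖ * dist p y ≤ lam * (1 / (2 * lam)) :=
    mul_le_mul hf hd.le dist_nonneg (by linarith)
  have h3 : lam * (1 / (2 * lam)) = 1 / 2 := by field_simp
  linarith

lemma aux_easy [CompleteSpace X] (W : Set X) (x : ℕ → X) (hxW : ∀ j, x j ∈ W) (hx : IsWideS x) :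
    ¬ RelWeaklyCompact W := by
  intro hW
  obtain ⟨lam, hlam, hb, -, hs⟩ := hx
  have hf : ∀ k : ℕ, ∃ f : StrongDual ℝ X, ‖f‖ ≤ lam ∧ ∀ j, f (x j) = if k ≤ j then 1 else 0 := by
    intro k
    apply aux_helly x _ lam (by linarith)
    intro c n
    have h1 : ∑ j ∈ Finset.range n, c j * (if k ≤ j then (1 : ℝ) else 0) =
        ∑ j ∈ Finset.Ico k n, c j := by
      simp only [mul_ite, mul_one, mul_zero]
      rw [← Finset.sum_filter]
      congr 1
      ext j
      simp only [Finset.mem_filter, Finset.mem_range, Finset.mem_Ico]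
      tauto
    rw [h1]
    by_cases hkn : k ≤ n
    · exact hs c k n hkn
    · rw [Finset.Ico_eq_empty_of_le (by omega)]
      simp only [Finset.sum_empty, abs_zero]
      positivity
  choose f hfn hf using hf
  obtain ⟨p, -, hp⟩ := hW.exists_mapClusterPt (f := (atTop : Filter ℕ))
    (u := fun j => (show WeakSpace ℝ X from x j))
    (by
      rw [Filter.le_principal_iff]
      exact Filter.mem_map.2 (Filter.Eventually.of_forall fun j => subset_closure (hxW j)))
  -- every continuous functional that eventually is constant on x takes that value at p
  have hval : ∀ (g : StrongDual ℝ X) (a : ℝ), (∀ᶠ j in atTop, g (x j) = a) →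
      g (show X from p) = a := by
    intro g a hg
    have hgc : Continuous (fun q : WeakSpace ℝ X => g (show X from q)) :=
      WeakBilin.eval_continuous (topDualPairing ℝ X).flip g
    have h1 := hp.continuousAt_comp hgc.continuousAt
    have h2 : Tendsto ((fun q : WeakSpace ℝ X => g (show X from q)) ∘
        fun j => (show WeakSpace ℝ X from x j)) atTop (𝓝 a) :=
      tendsto_const_nhds.congr' (hg.mono fun j hj => hj.symm)
    have h3 : ClusterPt (g (show X from p)) (𝓝 a) := ClusterPt.mono h1 h2
    exact eq_of_nhds_neBot h3
  have hpcl : (show X from p) ∈ closure ((Submodule.span ℝ (Set.range x) : Submodule ℝ X) : Set X) := by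
    have h1 := (Submodule.span ℝ (Set.range x)).convex.toWeakSpace_closure (𝕜 := ℝ)
    have h2 : p ∈ closure (toWeakSpace ℝ X ''
        ((Submodule.span ℝ (Set.range x) : Submodule ℝ X) : Set X)) := by
      rw [mem_closure_iff_clusterPt]
      refine ClusterPt.mono hp ?_
      rw [Filter.le_principal_iff]
      exact Filter.mem_map.2 (Filter.Eventually.of_forall fun j =>
        ⟨x j, Submodule.subset_span ⟨j, rfl⟩, rfl⟩)
    rw [← h1] at h2
    obtain ⟨q, hq, rfl⟩ := h2
    exact hq
  obtain ⟨y, hy, hyd⟩ := Metric.mem_closure_iff.1 hpcl (1 / (2 * lam)) (by positivity)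
  have hker : ∃ n, f n y = 0 := by
    obtain ⟨c, rfl⟩ := Finsupp.mem_span_range_iff_exists_finsupp.1 hy
    obtain ⟨n, hn⟩ := c.support.exists_nat_subset_range
    refine ⟨n, ?_⟩
    rw [Finsupp.sum, map_sum]
    refine Finset.sum_eq_zero fun j hj => ?_
    have hjn := Finset.mem_range.1 (hn hj)
    rw [map_smul, hf, if_neg (by omega), smul_zero]
  obtain ⟨n, hn⟩ := hker
  have hp1 : f n (show X from p) = 1 := hval _ _ (by
    filter_upwards [eventually_ge_atTop n] with j hj
    rw [hf, if_pos hj])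
  exact aux_contra (f n) _ y hp1 hn lam hlam (hfn n) hyd

lemma aux_dist {E Z : Type*} [NormedAddCommGroup E] [NormedSpace ℝ E] [CompleteSpace E]
    [NormedAddCommGroup Z] [NormedSpace ℝ Z] (J : E →L[ℝ] Z) (hJn : ∀ y, ‖J y‖ = ‖y‖) (G : Z)
    (hGr : G ∉ Set.range J) : ∃ d > 0, ∀ (y : E) (s : ℝ), d * |s| ≤ ‖J y + s • G‖ := by
  have hcl : IsClosed (Set.range J) := 
    (AddMonoidHomClass.isometry_of_norm J hJn).isClosedEmbedding.isClosed_range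
  obtain ⟨d, hd, hball⟩ := Metric.isOpen_iff.1 hcl.isOpen_compl G hGr
  refine ⟨d, hd, fun y s => ?_⟩
  by_cases hs : s = 0
  · simp [hs]
  have h1 : d ≤ ‖J (-(s⁻¹ • y)) - G‖ := by
    by_contra hlt
    exact hball (by rw [Metric.mem_ball, dist_eq_norm]; exact not_le.1 hlt) ⟨_, rfl⟩
  have h2 : J y + s • G = (-s) • (J (-(s⁻¹ • y)) - G) := by
    rw [smul_sub, ← map_smul]; simp [smul_smul, hs]
  rw [h2, norm_smul, norm_neg, Real.norm_eq_abs, mul_comm]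
  gcongr

lemma aux_tri {Z : Type*} [NormedAddCommGroup Z] [NormedSpace ℝ Z] (a g : Z) (s : ℝ) :
    ‖a‖ ≤ ‖a + s • g‖ + |s| * ‖g‖ := by
  have := norm_sub_le (a + s • g) (s • g)
  rwa [add_sub_cancel_right, norm_smul, Real.norm_eq_abs] at this

set_option maxHeartbeats 2000000 in
lemma aux_hard [CompleteSpace X] (W : Set X) (hW : Bornology.IsBounded W)
    (h : ¬ RelWeaklyCompact W) :
    ∃ x : ℕ → X, (∀ j, x j ∈ W) ∧ IsWideS x := by
  classical
  -- a bidual functional in the weak-star closure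
  obtain ⟨G, hGc, hGr⟩ : ∃ G : StrongDual ℝ (StrongDual ℝ X),
      (∀ (F : Finset (StrongDual ℝ X)) (ε : ℝ), 0 < ε → ∃ x ∈ W, ∀ f ∈ F, |f x - G f| < ε) ∧
      G ∉ Set.range (inclusionInDoubleDual ℝ X) := by
    have h1 := mt (NormedSpace.isCompact_closure_of_isBounded ℝ X
      (show Set (WeakSpace ℝ X) from W) hW) h
    obtain ⟨G, hG, hG'⟩ := Set.not_subset.1 h1
    refine ⟨WeakDual.toStrongDual G, ?_, ?_⟩
    · intro F ε hε
      let U : Set (WeakDual ℝ (StrongDual ℝ X)) := {H | ∀ f ∈ F, |H f - G f| < ε}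
      have hU : IsOpen U := by
        have : U = ⋂ f ∈ F, {H | |H f - G f| < ε} := by ext; simp [U]
        rw [this]
        refine isOpen_biInter_finset fun f _ => ?_
        exact isOpen_lt (((WeakDual.eval_continuous f).sub continuous_const).abs) continuous_const
      obtain ⟨H, hHU, w, hw, rfl⟩ := mem_closure_iff.1 hG U hU (by intro f _; simpa using hε)
      exact ⟨w, hw, fun f hf => hHU f hf⟩
    · rintro ⟨y, hy⟩
      exact hG' ⟨toWeakSpace ℝ X y, hy⟩
  set J := inclusionInDoubleDual ℝ X with hJ
  have hJn : ∀ y, ‖J y‖ = ‖y‖ := fun y => (inclusionInDoubleDualLi ℝ (E := X)).norm_map y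
  obtain ⟨d, hd, hdist⟩ := aux_dist J hJn G hGr
  obtain ⟨B, hB⟩ := hW.exists_norm_le
  -- norming sets
  have hN : ∀ T : Finset X, ∃ F : Finset (StrongDual ℝ X), (∀ f ∈ F, ‖f‖ ≤ 1) ∧
      ∀ v ∈ Submodule.span ℝ (insert G (J '' (T : Set X))), ∃ f ∈ F, ‖v‖ ≤ 2 * |v f| := by
    intro T
    have : FiniteDimensional ℝ (Submodule.span ℝ (insert G (J '' (T : Set X)))) :=
      FiniteDimensional.span_of_finite ℝ ((T.finite_toSet.image J).insert G)
    exact aux_norming _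
  choose N hN1 hN2 using hN
  let δ : ℝ := d / 16
  have hδ : 0 < δ := by positivity
  obtain ⟨x, hx⟩ := aux_seq (fun n (S : Finset X) y => y ∈ W ∧ ∀ T ⊆ S, ∀ f ∈ N T,
      |f y - G f| < δ * (1 / 2) ^ n) (by
    intro n S
    obtain ⟨y, hy, hyF⟩ := hGc (S.powerset.biUnion N) (δ * (1 / 2) ^ n) (by positivity)
    exact ⟨y, hy, fun T hT f hf => hyF f
      (Finset.mem_biUnion.2 ⟨T, Finset.mem_powerset.2 hT, hf⟩)⟩)
  refine ⟨x, fun j => (hx j).1, ?_⟩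
  -- main estimate
  have main : ∀ (c : ℕ → ℝ) (n : ℕ), ∀ k ≤ n,
      |∑ j ∈ Finset.Ico k n, c j| ≤ 4 / d * ‖∑ j ∈ Finset.range n, c j • x j‖ ∧
      ‖∑ j ∈ Finset.range k, c j • x j‖ ≤
        (4 + 4 / d * ‖G‖) * ‖∑ j ∈ Finset.range n, c j • x j‖ := by
    intro c n
    set y := ∑ j ∈ Finset.range n, c j • x j with hy
    let s : ℕ → ℝ := fun k => ∑ j ∈ Finset.Ico k n, c j
    obtain ⟨k0, hk0, hmax⟩ := Finset.exists_max_image (Finset.range (n + 1)) (fun k => |s k|)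
      ⟨0, by simp⟩
    set M := |s k0| with hM
    have hM0 : 0 ≤ M := abs_nonneg _
    have hc : ∀ j < n, |c j| ≤ 2 * M := by
      intro j hj
      have h1 : s j = c j + s (j + 1) := Finset.sum_eq_sum_Ico_succ_bot hj c
      have h2 := hmax j (by simp; omega)
      have h3 := hmax (j + 1) (by simp; omega)
      have h4 : c j = s j - s (j + 1) := by linarith
      rw [h4]
      have := abs_sub (s j) (s (j + 1))
      linarith
    have hv : ∀ k ≤ n, ‖J (∑ j ∈ Finset.range k, c j • x j) + s k • G‖ ≤ 2 * ‖y‖ + d / 2 * M := by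
      intro k hk
      set v := J (∑ j ∈ Finset.range k, c j • x j) + s k • G with hvdef
      have hvV : v ∈ Submodule.span ℝ
          (insert G (J '' (((Finset.range k).image x : Finset X) : Set X))) := by
        refine Submodule.add_mem _ ?_ (Submodule.smul_mem _ _ (Submodule.subset_span (by simp)))
        rw [map_sum]
        refine Submodule.sum_mem _ fun j hj => ?_
        rw [map_smul]
        refine Submodule.smul_mem _ _ (Submodule.subset_span (Or.inr ⟨x j, ?_, rfl⟩))
        exact Finset.mem_coe.2 (Finset.mem_image_of_mem x hj)
      obtain ⟨f, hf, hvf⟩ := hN2 _ v hvV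
      have hf1 := hN1 _ f hf
      have hfy : |f y| ≤ ‖y‖ := by
        have := f.le_opNorm y
        rw [Real.norm_eq_abs] at this
        nlinarith [norm_nonneg y]
      have e1 : v f = ∑ j ∈ Finset.range k, c j * f (x j) + ∑ j ∈ Finset.Ico k n, c j * G f := by
        have : v f = f (∑ j ∈ Finset.range k, c j • x j) + s k * G f := rfl
        rw [this, map_sum, Finset.sum_mul]
        simp
      have e2 : f y = ∑ j ∈ Finset.range k, c j * f (x j) +
          ∑ j ∈ Finset.Ico k n, c j * f (x j) := by
        rw [Finset.sum_range_add_sum_Ico _ hk, hy, map_sum]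
        simp
      have e3 : v f = f y - ∑ j ∈ Finset.Ico k n, c j * (f (x j) - G f) := by
        rw [e1, e2]
        simp only [mul_sub, Finset.sum_sub_distrib]
        ring
      have e4 : |∑ j ∈ Finset.Ico k n, c j * (f (x j) - G f)| ≤ d / 4 * M := by
        calc |∑ j ∈ Finset.Ico k n, c j * (f (x j) - G f)|
            ≤ ∑ j ∈ Finset.Ico k n, |c j * (f (x j) - G f)| := Finset.abs_sum_le_sum_abs _ _
          _ ≤ ∑ j ∈ Finset.Ico k n, (2 * M) * (δ * (1 / 2) ^ j) := by
              refine Finset.sum_le_sum fun j hj => ?_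
              rw [Finset.mem_Ico] at hj
              rw [abs_mul]
              refine mul_le_mul (hc j hj.2) ?_ (abs_nonneg _) (by positivity)
              refine ((hx j).2 _ ?_ f hf).le
              exact Finset.image_subset_image (by simpa using hj.1)
          _ ≤ ∑ j ∈ Finset.range n, (2 * M) * (δ * (1 / 2) ^ j) := by
              refine Finset.sum_le_sum_of_subset_of_nonneg ?_ (fun _ _ _ => by positivity)
              intro j hj
              simp only [Finset.mem_Ico, Finset.mem_range] at *
              exact hj.2
          _ = (2 * M * δ) * ∑ j ∈ Finset.range n, (1 / 2 : ℝ) ^ j := by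
              rw [Finset.mul_sum]
              exact Finset.sum_congr rfl fun _ _ => by ring
          _ ≤ (2 * M * δ) * 2 := by
              gcongr
              exact sum_geometric_two_le n
          _ = d / 4 * M := by simp only [δ]; ring
      have e5 : |v f| ≤ ‖y‖ + d / 4 * M := by
        rw [e3]
        have := abs_sub (f y) (∑ j ∈ Finset.Ico k n, c j * (f (x j) - G f))
        linarith
      linarith
    have hMy : d * M ≤ 4 * ‖y‖ := by
      have h1 := hdist (∑ j ∈ Finset.range k0, c j • x j) (s k0)
      have h2 := hv k0 (by simp at hk0; omega)
      have h3 : d * |s k0| = d * M := rfl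
      linarith
    have hMy' : M ≤ 4 / d * ‖y‖ := by
      rw [div_mul_eq_mul_div, le_div_iff₀ hd]; linarith
    intro k hk
    have hsk : |s k| ≤ M := hmax k (by simp; omega)
    refine ⟨hsk.trans hMy', ?_⟩
    have h1 := hv k hk
    have h2 := aux_tri (J (∑ j ∈ Finset.range k, c j • x j)) G (s k)
    have h2n := hJn (∑ j ∈ Finset.range k, c j • x j)
    have h3 : |s k| * ‖G‖ ≤ 4 / d * ‖y‖ * ‖G‖ := by
      gcongr
      exact hsk.trans hMy'
    linarith
  have hd4 : 0 < 4 / d := by positivity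
  have hG0 : 0 ≤ 4 / d * ‖G‖ := by positivity
  refine ⟨4 + 4 / d * ‖G‖ + 4 / d + |B|, by linarith [abs_nonneg B], ?_, ?_, ?_⟩
  · intro c k n hk
    refine ((main c n k hk).2).trans ?_
    gcongr
    linarith [abs_nonneg B]
  · intro j
    linarith [hB _ (hx j).1, le_abs_self B]
  · intro c k n hk
    refine ((main c n k hk).1).trans ?_
    gcongr
    linarith [abs_nonneg B]

/-- A bounded subset `W` of a Banach space `X` is not relatively weakly
compact iff there is a sequence of elements of `W` which is a wide-(s) sequence. -/
theorem stmt_0 [CompleteSpace X] (W : Set X) (hW : Bornology.IsBounded W) :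
    ¬ RelWeaklyCompact W ↔ ∃ x : ℕ → X, (∀ j, x j ∈ W) ∧ IsWideS x := by
  constructor
  · exact aux_hard W hW
  · rintro ⟨x, hx, hxs⟩
    exact aux_easy W x hx hxs
end
end

section
/- A real Banach space X is non-reflexive if and only if X contains a wide-(s) sequence. -/
open Finset Filter Metric NormedSpace

noncomputable section

universe u

variable {X Y : Type*} [NormedAddCommGroup X] [NormedSpace ℝ X]
  [NormedAddCommGroup Y] [NormedSpace ℝ Y]

lemma norm_smul_abs {E : Type*} [NormedAddCommGroup E] [NormedSpace ℝ E] (s : ℝ) (v : E) :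
    ‖s • v‖ = |s| * ‖v‖ := by
  rw [norm_smul, Real.norm_eq_abs]

lemma dist_eq_norm_sub_aux {E : Type*} [NormedAddCommGroup E] (v w : E) :
    dist v w = ‖v - w‖ := dist_eq_norm v w

/-- finite norming set -/
lemma exists_norming {E : Type*} [NormedAddCommGroup E] [NormedSpace ℝ E]
    (F : Submodule ℝ (StrongDual ℝ E)) [FiniteDimensional ℝ F] :
    ∃ A : Finset E, (∀ g ∈ A, ‖g‖ ≤ 1) ∧ ∀ z ∈ F, ∃ g ∈ A, ‖z‖ ≤ 2 * z g := by
  classical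
  have hc : IsCompact (sphere (0 : F) 1) := isCompact_sphere 0 1
  have key : ∀ z : F, z ∈ sphere (0 : F) 1 → ∃ g : E, ‖g‖ ≤ 1 ∧ 1 / 2 < (z : StrongDual ℝ E) g := by
    intro z hz
    have hz1 : ‖(z : StrongDual ℝ E)‖ = 1 := mem_sphere_zero_iff_norm.1 hz
    obtain ⟨g, hg, hg'⟩ := ContinuousLinearMap.exists_lt_apply_of_lt_opNorm
      (z : StrongDual ℝ E) (r := 1 / 2) (by rw [hz1]; norm_num)
    rw [Real.norm_eq_abs] at hg'
    rcases lt_abs.1 hg' with h | h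
    · exact ⟨g, hg.le, h⟩
    · exact ⟨-g, by simpa using hg.le, by simpa using h⟩
  let U : E → Set F := fun g => {z | 1 / 2 < (z : StrongDual ℝ E) g}
  have hU : ∀ g, IsOpen (U g) := fun g =>
    isOpen_lt continuous_const
      ((ContinuousLinearMap.apply ℝ ℝ g).continuous.comp continuous_subtype_val)
  obtain ⟨t, ht, hcov⟩ := hc.elim_finite_subcover_image (b := {g : E | ‖g‖ ≤ 1}) (c := U)
    (fun g _ => hU g) (by
      intro z hz
      obtain ⟨g, h1, h2⟩ := key z hz
      simp only [Set.mem_iUnion]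
      exact ⟨g, h1, h2⟩)
  obtain ⟨hfin, hcov⟩ := hcov
  refine ⟨insert 0 hfin.toFinset, ?_, ?_⟩
  · intro g hg
    rcases Finset.mem_insert.1 hg with rfl | hg
    · simp
    · exact ht (hfin.mem_toFinset.1 hg)
  · intro z hz
    by_cases h0 : z = 0
    · exact ⟨0, by simp, by simp [h0]⟩
    have hn : 0 < ‖z‖ := norm_pos_iff.2 h0
    have hmem : (‖z‖⁻¹ • (⟨z, hz⟩ : F)) ∈ sphere (0 : F) 1 := by
      refine (mem_sphere_zero_iff_norm (E := F)).2 ?_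
      change ‖‖z‖⁻¹ • z‖ = 1
      have e := norm_smul_abs ‖z‖⁻¹ z
      rw [abs_of_pos (inv_pos.2 hn), inv_mul_cancel₀ hn.ne'] at e
      exact e
    have := hcov hmem
    simp only [Set.mem_iUnion] at this
    obtain ⟨g, hg, hgU⟩ := this
    refine ⟨g, Finset.mem_insert_of_mem (hfin.mem_toFinset.2 hg), ?_⟩
    have h2 : 1 / 2 < ‖z‖⁻¹ * z g := by simpa [U] using hgU
    rw [inv_mul_eq_div, lt_div_iff₀ hn] at h2
    linarith

/-- Helly -/
lemma helly [CompleteSpace X] (ξ : StrongDual ℝ (StrongDual ℝ X)) (A : Finset (StrongDual ℝ X)) :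
    ∃ x : X, ‖x‖ ≤ ‖ξ‖ + 1 ∧ ∀ g ∈ A, g x = ξ g := by
  classical
  let T : X →L[ℝ] (A → ℝ) := ContinuousLinearMap.pi (fun g => (g : StrongDual ℝ X))
  let v : A → ℝ := fun g => ξ g
  have hv : v ∈ closure (T '' closedBall 0 ‖ξ‖) := by
    by_contra hv
    obtain ⟨φ, u, h1, h2⟩ := geometric_hahn_banach_closed_point
      (((convex_closedBall (0 : X) ‖ξ‖).is_linear_image T.toLinearMap.isLinear).closure)
      isClosed_closure hv
    have h1' : ∀ x : X, ‖x‖ ≤ ‖ξ‖ → φ (T x) < u := fun x hx =>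
      h1 _ (subset_closure ⟨x, by simpa using hx, rfl⟩)
    let a : A → ℝ := fun g => φ (Pi.single g 1)
    have hφ : ∀ w : A → ℝ, φ w = ∑ g, w g * a g := by
      intro w
      conv_lhs => rw [← Finset.univ_sum_single w]
      rw [map_sum]
      refine Finset.sum_congr rfl fun g _ => ?_
      have : (Pi.single g (w g) : A → ℝ) = w g • Pi.single g (1 : ℝ) := by
        rw [← Pi.single_smul]; simp
      rw [this, map_smul, smul_eq_mul]
    let h : StrongDual ℝ X := ∑ g, a g • (g : StrongDual ℝ X)
    have hT : ∀ x, φ (T x) = h x := by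
      intro x
      rw [hφ]
      simp [h, T, mul_comm]
    have hξ : φ v = ξ h := by
      rw [hφ]
      simp [h, v, mul_comm]
    have hb : ‖ξ‖ * ‖h‖ ≤ u := by
      have h0 : 0 < u := by simpa using h1' 0 (by rw [norm_zero]; exact norm_nonneg ξ)
      by_cases hz : ‖ξ‖ = 0
      · rw [hz]; linarith
      have hp : 0 < ‖ξ‖ := lt_of_le_of_ne (norm_nonneg ξ) (Ne.symm hz)
      rw [← le_div_iff₀' hp]
      refine ContinuousLinearMap.opNorm_le_of_unit_norm (𝕜 := ℝ) (by positivity) ?_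
      intro x hx
      rw [le_div_iff₀' hp, Real.norm_eq_abs]
      have e : ‖ξ‖ * |h x| = |‖ξ‖ * h x| := by rw [abs_mul, abs_of_pos hp]
      rw [e]
      refine abs_le.2 ⟨?_, ?_⟩
      · have := h1' ((-‖ξ‖) • x) (by simp [norm_smul, hx, abs_of_pos hp])
        rw [hT] at this
        simp at this
        linarith
      · have := h1' (‖ξ‖ • x) (by simp [norm_smul, hx, abs_of_pos hp])
        rw [hT] at this
        simp at this
        linarith
    have := (le_abs_self _).trans (ξ.le_opNorm h)
    linarith
  let W := T.toLinearMap.range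
  let S : X →L[ℝ] W := T.rangeRestrict
  have hS : Function.Surjective S := T.toLinearMap.surjective_rangeRestrict
  obtain ⟨C, hC, hCS⟩ := S.exists_preimage_norm_le hS
  have hW : IsClosed (W : Set (A → ℝ)) := W.closed_of_finiteDimensional
  have hvW : v ∈ W := closure_minimal (by rintro _ ⟨x, -, rfl⟩; exact ⟨x, rfl⟩) hW hv
  obtain ⟨_, ⟨x, hx, rfl⟩, hd⟩ := Metric.mem_closure_iff.1 hv (1 / C) (by positivity)
  obtain ⟨y, hy, hy'⟩ := hCS (⟨v, hvW⟩ - S x)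
  have hn : ‖(⟨v, hvW⟩ - S x : W)‖ < 1 / C := by
    rw [dist_eq_norm] at hd; exact hd
  refine ⟨x + y, ?_, ?_⟩
  · have : ‖y‖ ≤ 1 := by
      refine hy'.trans ?_
      rw [lt_div_iff₀' hC] at hn
      exact hn.le
    have hx' : ‖x‖ ≤ ‖ξ‖ := by simpa using hx
    linarith [norm_add_le x y]
  · intro g hg
    have e : S (x + y) = ⟨v, hvW⟩ := by rw [map_add, hy]; abel
    have e2 : T (x + y) = v := congrArg Subtype.val e
    exact congrFun e2 ⟨g, hg⟩

/-- The sum of the tail of a finitely supported scalar sequence. -/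
def tailSum (k : ℕ) : (ℕ →₀ ℝ) →ₗ[ℝ] ℝ :=
  Finsupp.linearCombination ℝ (fun j => if k ≤ j then (1 : ℝ) else 0)

lemma tailSum_eq (k n : ℕ) (l : ℕ →₀ ℝ) (h : l.support ⊆ Finset.range n) :
    tailSum k l = ∑ j ∈ Finset.Ico k n, l j := by
  rw [tailSum, Finsupp.linearCombination_apply,
    Finsupp.sum_of_support_subset l h _ (by simp), Finset.range_eq_Ico]
  simp only [smul_eq_mul, mul_ite, mul_one, mul_zero]
  rw [← Finset.sum_filter]
  refine Finset.sum_congr ?_ fun _ _ => rfl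
  ext j
  simp
  tauto

lemma exists_supp (l : ℕ →₀ ℝ) : ∃ n, l.support ⊆ Finset.range n :=
  l.support.exists_nat_subset_range

lemma tailSum_bound {lam : ℝ} {b : ℕ → X} (hb : IsWideSWith lam b) (k : ℕ) (l : ℕ →₀ ℝ) :
    |tailSum k l| ≤ lam * ‖Finsupp.linearCombination ℝ b l‖ := by
  obtain ⟨n, hn⟩ := exists_supp l
  have hn' : l.support ⊆ Finset.range (max k n) :=
    hn.trans (Finset.range_subset_range.2 (le_max_right _ _))
  rw [tailSum_eq k _ l hn', Finsupp.linearCombination_apply,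
    Finsupp.sum_of_support_subset l hn' _ (by simp)]
  exact hb.2.2 l k _ (le_max_left _ _)

lemma wide_linInd {lam : ℝ} {b : ℕ → X} (hb : IsWideSWith lam b) : LinearIndependent ℝ b := by
  rw [linearIndependent_iff]
  intro l hl
  have h0 : ∀ k, tailSum k l = 0 := by
    intro k
    have := tailSum_bound hb k l
    rw [hl] at this
    simpa using this
  ext k
  obtain ⟨n, hn⟩ := exists_supp l
  have hn' : l.support ⊆ Finset.range (max (k + 1) n) :=
    hn.trans (Finset.range_subset_range.2 (le_max_right _ _))
  have h1 := h0 k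
  have h2 := h0 (k + 1)
  rw [tailSum_eq _ _ l hn'] at h1 h2
  rw [Finset.sum_eq_sum_Ico_succ_bot (by omega), h2] at h1
  simpa using h1

lemma exists_tail_functional {lam : ℝ} (hlam : 0 ≤ lam) {b : ℕ → X} (hb : IsWideSWith lam b)
    (k : ℕ) : ∃ f : StrongDual ℝ X, ‖f‖ ≤ lam ∧
      ∀ l : ℕ →₀ ℝ, f (Finsupp.linearCombination ℝ b l) = tailSum k l := by
  have hli := wide_linInd hb
  let f0 : Submodule.span ℝ (Set.range b) →ₗ[ℝ] ℝ := (tailSum k) ∘ₗ hli.repr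
  have hf0 : ∀ x, ‖f0 x‖ ≤ lam * ‖x‖ := by
    intro x
    have := tailSum_bound hb k (hli.repr x)
    rw [hli.linearCombination_repr] at this
    exact this
  obtain ⟨f, hf, hfn⟩ := exists_extension_norm_eq _ (f0.mkContinuous lam hf0)
  refine ⟨f, hfn ▸ f0.mkContinuous_norm_le hlam hf0, fun l => ?_⟩
  have hm : Finsupp.linearCombination ℝ b l ∈ Submodule.span ℝ (Set.range b) :=
    Finsupp.mem_span_range_iff_exists_finsupp.2 ⟨l, rfl⟩
  have := hf ⟨_, hm⟩
  simp only [LinearMap.mkContinuous_apply] at this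
  rw [this]
  simp only [f0, LinearMap.comp_apply]
  rw [hli.repr_eq rfl]

lemma not_reflexive_of_wide {b : ℕ → X} (hw : IsWideS b) :
    ¬ Function.Surjective (inclusionInDoubleDual ℝ X) := by
  intro hsurj
  obtain ⟨lam, h1, hb⟩ := hw
  have h0 : (0 : ℝ) < lam := by linarith
  obtain ⟨x, hx⟩ : ∃ x : X, ∀ f : StrongDual ℝ X,
      Tendsto (fun j => f (b j)) (hyperfilter ℕ) (nhds (f x)) := by
    have hc := WeakDual.isCompact_closedBall (𝕜 := ℝ) (0 : StrongDual ℝ (StrongDual ℝ X)) lam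
    let u : ℕ → WeakDual ℝ (StrongDual ℝ X) :=
      fun j => StrongDual.toWeakDual (inclusionInDoubleDual ℝ X (b j))
    obtain ⟨G, -, hG⟩ := hc.ultrafilter_le_nhds ((hyperfilter ℕ).map u) (by
      rw [le_principal_iff]
      refine Filter.mem_map.2 (Filter.univ_mem' fun j => ?_)
      simp only [Set.mem_preimage, u]
      simpa using (double_dual_bound ℝ X (b j)).trans (hb.2.1 j))
    obtain ⟨x, hx⟩ := hsurj (WeakDual.toStrongDual G)
    refine ⟨x, fun f => ?_⟩
    have ht : Tendsto u (hyperfilter ℕ) (nhds G) := hG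
    have := ((WeakDual.eval_continuous f).tendsto G).comp ht
    have e : f x = G f := by
      rw [← dual_def ℝ X x f, hx]; rfl
    rw [e]
    exact this
  have hxc : x ∈ closure (Submodule.span ℝ (Set.range b) : Set X) := by
    by_contra hn
    obtain ⟨φ, u, hu, hu'⟩ := geometric_hahn_banach_closed_point
      ((Submodule.span ℝ (Set.range b)).convex.closure) isClosed_closure hn
    have : φ x ≤ u := le_of_tendsto (hx φ) (Filter.Eventually.of_forall fun j =>
      (hu _ (subset_closure (Submodule.subset_span ⟨j, rfl⟩))).le)
    linarith
  obtain ⟨y, hy, hxy⟩ := Metric.mem_closure_iff.1 hxc (1 / lam) (by positivity)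
  obtain ⟨l, rfl⟩ := Finsupp.mem_span_range_iff_exists_finsupp.1 hy
  obtain ⟨n, hn⟩ := exists_supp l
  obtain ⟨f, hf, hfl⟩ := exists_tail_functional h0.le hb n
  have e1 : f x = 1 := by
    refine tendsto_nhds_unique (hx f) ?_
    refine tendsto_const_nhds.congr' ?_
    have : ∀ᶠ j in (hyperfilter ℕ : Filter ℕ), n ≤ j :=
      Nat.hyperfilter_le_atTop (eventually_ge_atTop n)
    filter_upwards [this] with j hj
    have := hfl (Finsupp.single j 1)
    simp [tailSum, hj] at this
    exact this.symm
  have e2 : f (l.sum fun i a => a • b i) = 0 := by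
    have := hfl l
    rw [Finsupp.linearCombination_apply] at this
    rw [this, tailSum_eq n n l hn]
    simp
  have e3 := f.le_of_opNorm_le hf (x - l.sum fun i a => a • b i)
  rw [map_sub, e1, e2] at e3
  rw [lt_div_iff₀' h0, dist_eq_norm] at hxy
  norm_num at e3
  linarith

lemma exists_wide [CompleteSpace X]
    (h : ¬ Function.Surjective (inclusionInDoubleDual ℝ X)) : ∃ b : ℕ → X, IsWideS b := by
  classical
  let J := inclusionInDoubleDual ℝ X
  obtain ⟨ξ, hξ⟩ : ∃ ξ, ∀ x, J x ≠ ξ := by simpa [Function.Surjective] using h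
  obtain ⟨δ, hδ, hdist⟩ : ∃ δ > 0, ∀ (y : X) (s : ℝ), δ * |s| ≤ ‖J y + s • ξ‖ := by
    have hcl : IsClosed (Set.range J) := by
      have hi : Isometry J := AddMonoidHomClass.isometry_of_norm J
        (inclusionInDoubleDualLi (E := X) ℝ).norm_map
      exact hi.isClosedEmbedding.isClosed_range
    have hne : (Set.range J).Nonempty := ⟨J 0, 0, rfl⟩
    have hm : ξ ∉ Set.range J := by rintro ⟨x, hx⟩; exact hξ x hx
    refine ⟨infDist ξ (Set.range J), (hcl.notMem_iff_infDist_pos hne).1 hm, fun y s => ?_⟩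
    by_cases hs : s = 0
    · rw [hs, abs_zero, mul_zero]
      exact norm_nonneg (J y + (0 : ℝ) • ξ)
    have h1 := infDist_le_dist_of_mem (x := ξ) (Set.mem_range_self (f := J) (-(s⁻¹ • y)))
    have h2 : J y + s • ξ = s • (ξ - J (-(s⁻¹ • y))) := by
      rw [map_neg, map_smul, sub_neg_eq_add, smul_add, smul_smul, mul_inv_cancel₀ hs, one_smul,
        add_comm]
    rw [dist_eq_norm_sub_aux ξ] at h1
    have h3 := norm_smul_abs s (ξ - J (-(s⁻¹ • y)))
    rw [h2, mul_comm]
    exact (mul_le_mul_of_nonneg_left h1 (abs_nonneg s)).trans h3.ge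
  have hA : ∀ S : Finset X, ∃ A : Finset (StrongDual ℝ X), (∀ g ∈ A, ‖g‖ ≤ 1) ∧
      ∀ y ∈ Submodule.span ℝ (S : Set X), ∀ s : ℝ, ∃ g ∈ A,
        ‖J y + s • ξ‖ ≤ 2 * (g y + s * ξ g) := by
    intro S
    let F := (Submodule.span ℝ (S : Set X)).map J.toLinearMap ⊔ Submodule.span ℝ {ξ}
    have : FiniteDimensional ℝ (Submodule.span ℝ (S : Set X)) :=
      FiniteDimensional.span_finset ℝ S
    obtain ⟨A, hA1, hA2⟩ := exists_norming F
    refine ⟨A, hA1, fun y hy s => ?_⟩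
    obtain ⟨g, hg, hg'⟩ := hA2 (J y + s • ξ) (Submodule.add_mem_sup
      (Submodule.mem_map_of_mem hy) (Submodule.smul_mem _ _ (Submodule.mem_span_singleton_self ξ)))
    exact ⟨g, hg, by simpa [J] using hg'⟩
  choose A hA1 hA2 using hA
  choose H hH1 hH2 using helly ξ
  let st : ℕ → Finset X × Finset (StrongDual ℝ X) := fun n => Nat.rec (∅, A ∅)
    (fun _ p => (insert (H p.2) p.1, p.2 ∪ A (insert (H p.2) p.1))) n
  have st1 : ∀ n, (st (n + 1)).1 = insert (H (st n).2) (st n).1 := fun _ => rfl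
  have st2 : ∀ n, (st (n + 1)).2 = (st n).2 ∪ A (st (n + 1)).1 := fun _ => rfl
  have hsub : ∀ n, A (st n).1 ⊆ (st n).2 := by
    intro n
    cases n with
    | zero => exact Finset.Subset.refl _
    | succ n => rw [st2]; exact Finset.subset_union_right
  have mono1 : Monotone fun n => (st n).1 :=
    monotone_nat_of_le_succ fun n => by rw [st1]; exact Finset.subset_insert _ _
  have mono2 : Monotone fun n => (st n).2 :=
    monotone_nat_of_le_succ fun n => by rw [st2]; exact Finset.subset_union_left
  let b : ℕ → X := fun n => H (st n).2
  have hbmem : ∀ j k, j < k → b j ∈ (st k).1 := by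
    intro j k hjk
    refine mono1 (Nat.succ_le_of_lt hjk) ?_
    simp only [Nat.succ_eq_add_one, st1]
    exact Finset.mem_insert_self _ _
  have key : ∀ (c : ℕ → ℝ) (k n : ℕ), k ≤ n →
      ‖J (∑ j ∈ Finset.range k, c j • b j) + (∑ j ∈ Finset.Ico k n, c j) • ξ‖
        ≤ 2 * ‖∑ j ∈ Finset.range n, c j • b j‖ := by
    intro c k n hkn
    obtain ⟨g, hg, hle⟩ := hA2 (st k).1 (∑ j ∈ Finset.range k, c j • b j)
      (Submodule.sum_mem _ fun j hj => Submodule.smul_mem _ _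
        (Submodule.subset_span (hbmem j k (Finset.mem_range.1 hj))))
      (∑ j ∈ Finset.Ico k n, c j)
    refine hle.trans ?_
    have e : g (∑ j ∈ Finset.range k, c j • b j) + (∑ j ∈ Finset.Ico k n, c j) * ξ g
        = g (∑ j ∈ Finset.range n, c j • b j) := by
      rw [← Finset.sum_range_add_sum_Ico _ hkn, map_add, map_sum g _ (Finset.Ico k n),
        Finset.sum_mul]
      congr 1
      refine Finset.sum_congr rfl fun j hj => ?_
      rw [map_smul, smul_eq_mul, hH2 _ g (mono2 (Finset.mem_Ico.1 hj).1 (hsub k hg))]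
    rw [e]
    have := (le_abs_self _).trans (g.le_of_opNorm_le (hA1 _ g hg)
      (∑ j ∈ Finset.range n, c j • b j))
    linarith
  have key2 : ∀ (c : ℕ → ℝ) (k n : ℕ), k ≤ n →
      |∑ j ∈ Finset.Ico k n, c j| ≤ 2 / δ * ‖∑ j ∈ Finset.range n, c j • b j‖ := by
    intro c k n hkn
    have := (hdist _ _).trans (key c k n hkn)
    rw [div_mul_eq_mul_div, le_div_iff₀' hδ]
    exact this
  have p1 : 0 ≤ 2 / δ := by positivity
  have p2 : 0 ≤ 2 / δ * ‖ξ‖ := by positivity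
  have p3 := norm_nonneg ξ
  refine ⟨b, 2 + ‖ξ‖ + 2 / δ + 2 / δ * ‖ξ‖, by linarith, ?_, ?_, ?_⟩
  · intro c k n hkn
    have h1 := key c k n hkn
    have h2 := key2 c k n hkn
    have h3 : ‖∑ j ∈ Finset.range k, c j • b j‖ = ‖J (∑ j ∈ Finset.range k, c j • b j)‖ :=
      ((inclusionInDoubleDualLi (E := X) ℝ).norm_map _).symm
    have h4 := norm_sub_le (J (∑ j ∈ Finset.range k, c j • b j) +
      (∑ j ∈ Finset.Ico k n, c j) • ξ) ((∑ j ∈ Finset.Ico k n, c j) • ξ)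
    rw [add_sub_cancel_right, ← h3] at h4
    have h7 := norm_smul_abs (∑ j ∈ Finset.Ico k n, c j) ξ
    rw [h7] at h4
    have h5 := mul_le_mul_of_nonneg_right h2 p3
    have h6 : (2 + 2 / δ * ‖ξ‖) * ‖∑ j ∈ Finset.range n, c j • b j‖ ≤
        2 * (2 + ‖ξ‖ + 2 / δ + 2 / δ * ‖ξ‖) * ‖∑ j ∈ Finset.range n, c j • b j‖ :=
      mul_le_mul_of_nonneg_right (by linarith) (norm_nonneg _)
    linarith
  · intro j
    have := hH1 (st j).2
    change ‖H (st j).2‖ ≤ _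
    linarith
  · intro c k n hkn
    exact (key2 c k n hkn).trans (mul_le_mul_of_nonneg_right (by linarith) (norm_nonneg _))

/-- A Banach space is non-reflexive iff it contains a wide-(s) sequence. -/
theorem stmt_2 [CompleteSpace X] :
    ¬ Function.Surjective (inclusionInDoubleDual ℝ X) ↔ ∃ b : ℕ → X, IsWideS b := by
  exact ⟨exists_wide, fun ⟨_, hb⟩ => not_reflexive_of_wide hb⟩
end
end

section
/- Let (x_j) be a bounded sequence in a real Banach space X which is not relatively compact in norm, and let ε > 0. Then there exist x ∈ X and a subsequence (x'_j) of (x_j) such that, setting b_j = x'_j − x for all j: (1) if {x_1, x_2, …} is relatively weakly compact, then (b_j) is a (1+ε)-basic sequence; (2) if {x_1, x_2, …} is not relatively weakly compact, then (b_j) is a (2+ε)-basic sequence, and moreover there exist a convex block basis (u_j) of (b_j) and c > 0 such that (c·u_j) has a (1+ε)-wide-(s) subsequence. -/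
open Finset Filter Metric NormedSpace

noncomputable section

universe u

variable {X Y : Type*} [NormedAddCommGroup X] [NormedSpace ℝ X]
  [NormedAddCommGroup Y] [NormedSpace ℝ Y]

/-- `u` is a convex block basis of `x`. -/
def IsConvexBlockBasis (u x : ℕ → X) : Prop :=
  ∃ (n : ℕ → ℕ) (a : ℕ → ℝ), StrictMono n ∧ (∀ i, 0 ≤ a i) ∧
    (∀ j, ∑ i ∈ Finset.Ico (n j) (n (j + 1)), a i = 1) ∧
    (∀ j, u j = ∑ i ∈ Finset.Ico (n j) (n (j + 1)), a i • x i)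

open Topology

/-- the bidual -/
def Bid (X : Type*) [NormedAddCommGroup X] [NormedSpace ℝ X] : Type _ :=
  StrongDual ℝ (StrongDual ℝ X)

instance (X : Type*) [NormedAddCommGroup X] [NormedSpace ℝ X] : NormedAddCommGroup (Bid X) :=
  inferInstanceAs (NormedAddCommGroup (StrongDual ℝ (StrongDual ℝ X)))

instance (X : Type*) [NormedAddCommGroup X] [NormedSpace ℝ X] : NormedSpace ℝ (Bid X) :=
  inferInstanceAs (NormedSpace ℝ (StrongDual ℝ (StrongDual ℝ X)))

/-- canonical isometric embedding in the bidual -/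
def Jm (X : Type*) [NormedAddCommGroup X] [NormedSpace ℝ X] :
    X →ₗᵢ[ℝ] Bid X := inclusionInDoubleDualLi (E := X) ℝ

/-- evaluation of an element of the bidual -/
def ev (φ : StrongDual ℝ X) : StrongDual ℝ (Bid X) :=
  inclusionInDoubleDual ℝ (StrongDual ℝ X) φ

lemma ev_Jm (v : X) (φ : StrongDual ℝ X) : ev φ (Jm X v) = φ v := rfl

lemma ev_neg (φ : StrongDual ℝ X) (G : Bid X) : ev (-φ) G = - ev φ G :=
  map_neg (F := StrongDual ℝ (StrongDual ℝ X)) G φ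

lemma ev_le (φ : StrongDual ℝ X) (G : Bid X) : |ev φ G| ≤ ‖G‖ * ‖φ‖ :=
  ContinuousLinearMap.le_opNorm (E := StrongDual ℝ X) (F := ℝ) G φ

lemma exists_ev (G : Bid X) (r : ℝ) (hr : r < ‖G‖) : ∃ φ : StrongDual ℝ X, ‖φ‖ < 1 ∧
    r < |ev φ G| :=
  ContinuousLinearMap.exists_lt_apply_of_lt_opNorm (E := StrongDual ℝ X) (F := ℝ) G hr

/-- weak-star convergence of `b` to `G` along `U`. -/
def WLim (U : Filter ℕ) (b : ℕ → X) (G : Bid X) : Prop :=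
  ∀ φ : StrongDual ℝ X, Tendsto (fun j => φ (b j)) U (𝓝 (ev φ G))

lemma exists_wlim (U : Ultrafilter ℕ) (b : ℕ → X) (hb : Bornology.IsBounded (Set.range b)) :
    ∃ G, WLim (U : Filter ℕ) b G := by
  obtain ⟨M, hM⟩ := hb.exists_norm_le
  have hc := WeakDual.isCompact_closedBall (𝕜 := ℝ) (E := StrongDual ℝ X) 0 M
  have := hc.ultrafilter_le_nhds (U.map (fun j => StrongDual.toWeakDual (Jm X (b j)))) (by
    rw [Filter.le_principal_iff]
    refine Filter.Eventually.of_forall (f := (U : Filter ℕ)) fun j => ?_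
    have := hM (b j) ⟨j, rfl⟩
    refine (mem_closedBall_zero_iff (E := StrongDual ℝ (StrongDual ℝ X))).2 ?_
    exact ((Jm X).norm_map (b j)).trans_le this)
  obtain ⟨G, -, hG⟩ := this
  refine ⟨WeakDual.toStrongDual G, fun φ => ?_⟩
  have h1 : Tendsto (fun j => StrongDual.toWeakDual (Jm X (b j))) (U : Filter ℕ) (𝓝 G) := hG
  exact ((WeakDual.eval_continuous φ).tendsto G).comp h1

lemma relWeaklyCompact_of (x : ℕ → X) (hx : Bornology.IsBounded (Set.range x))
    (h : ∀ U : Ultrafilter ℕ, ∀ G, WLim (U : Filter ℕ) x G → ∃ y, Jm X y = G) :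
    RelWeaklyCompact (Set.range x) := by
  refine NormedSpace.isCompact_closure_of_isBounded ℝ X (show Set (WeakSpace ℝ X) from Set.range x) hx ?_
  intro G hG
  rw [mem_closure_iff_ultrafilter] at hG
  obtain ⟨F, hF, hFG⟩ := hG
  set f : ℕ → WeakDual ℝ (StrongDual ℝ X) := fun j => StrongDual.toWeakDual (Jm X (x j)) with hf
  have hr : Set.range f ∈ F := by
    refine mem_of_superset hF ?_
    rintro _ ⟨_, ⟨j, rfl⟩, rfl⟩
    exact ⟨j, rfl⟩
  have hne : (comap f (F : Filter _)).NeBot := by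
    rw [comap_neBot_iff]
    intro t ht
    obtain ⟨z, hz, j, rfl⟩ := F.nonempty_of_mem (inter_mem ht hr)
    exact ⟨j, hz⟩
  let U := Ultrafilter.of (comap f (F : Filter _))
  have hU : Tendsto f (U : Filter ℕ) (𝓝 G) :=
    (tendsto_comap.mono_left (Ultrafilter.of_le _)).mono_right hFG
  obtain ⟨y, hy⟩ := h U (WeakDual.toStrongDual G)
    (fun φ => ((WeakDual.eval_continuous φ).tendsto G).comp hU)
  exact ⟨y, hy⟩

lemma wlim_of_relWeaklyCompact (x : ℕ → X) (h : RelWeaklyCompact (Set.range x))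
    (U : Ultrafilter ℕ) : ∃ y, WLim (U : Filter ℕ) x (Jm X y) := by
  have := h.ultrafilter_le_nhds (U.map (fun j => (toWeakSpace ℝ X) (x j))) (by
    rw [Filter.le_principal_iff]
    refine Filter.Eventually.of_forall (f := (U : Filter ℕ)) fun j => ?_
    exact subset_closure ⟨j, rfl⟩)
  obtain ⟨y, -, hy⟩ := this
  have h1 : Tendsto (fun j => (toWeakSpace ℝ X) (x j)) (U : Filter ℕ) (𝓝 y) := hy
  refine ⟨(toWeakSpace ℝ X).symm y, fun φ => ?_⟩
  have h2 := ((WeakDual.eval_continuous φ).comp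
    (inclusionInDoubleDualWeak ℝ X).continuous).tendsto y
  exact h2.comp h1

lemma ultrafilter_le_atTop_of (U : Ultrafilter ℕ) (h : ∀ n, U ≠ pure n) :
    (U : Filter ℕ) ≤ atTop := by
  rcases U.le_cofinite_or_eq_pure with h1 | ⟨n, h1⟩
  · rwa [Nat.cofinite_eq_atTop] at h1
  · exact absurd h1 (h n)

lemma exists_ultrafilter_not_conv [CompleteSpace X] (x : ℕ → X)
    (hnc : ¬ IsCompact (closure (Set.range x))) :
    ∃ U : Ultrafilter ℕ, (U : Filter ℕ) ≤ atTop ∧ ∀ y, ¬ Tendsto x U (𝓝 y) := by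
  by_contra! hcon
  have hcon' : ∀ U : Ultrafilter ℕ, ∃ y, Tendsto x U (𝓝 y) := by
    intro U
    by_cases hU : ∃ n, U = pure n
    · obtain ⟨n, rfl⟩ := hU
      exact ⟨x n, tendsto_pure_nhds x n⟩
    · push Not at hU
      exact hcon U (ultrafilter_le_atTop_of U hU)
  apply hnc
  refine TotallyBounded.isCompact_of_isClosed ?_ isClosed_closure
  refine TotallyBounded.closure ?_
  rw [totallyBounded_iff_ultrafilter]
  intro F hF
  have hne : (comap x (F : Filter _)).NeBot := by
    rw [comap_neBot_iff]
    intro t ht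
    obtain ⟨z, hz, j, rfl⟩ := F.nonempty_of_mem (inter_mem ht (le_principal_iff.1 hF))
    exact ⟨j, hz⟩
  let U := Ultrafilter.of (comap x (F : Filter _))
  have hU : Tendsto x (U : Filter ℕ) F := tendsto_comap.mono_left (Ultrafilter.of_le _)
  obtain ⟨y, hy⟩ := hcon' U
  have : (U.map x) = F := Ultrafilter.coe_le_coe.1 hU
  have h2 : (F : Filter X) ≤ 𝓝 y := by rw [← this]; exact hy
  exact cauchy_nhds.mono h2

/-- one Mazur step -/
lemma mazur_step (U : Filter ℕ) (b : ℕ → X) (H : Bid X)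
    (hH : WLim U b H) (δ : ℝ) (hδ : 0 < δ) (hsep : ∀ᶠ j in U, δ ≤ ‖Jm X (b j) - H‖)
    (E : Submodule ℝ (Bid X)) [FiniteDimensional ℝ E]
    (q : ℝ) (hq : 1 < q) :
    ∀ᶠ j in U, ∀ e ∈ E, ∀ t : ℝ, ‖e‖ ≤ q * ‖e + t • (Jm X (b j) - H)‖ := by
  have hK : IsCompact ((Subtype.val : E → _) '' (sphere (0 : E) 1)) :=
    (isCompact_sphere (0 : E) 1).image continuous_subtype_val
  have key : ∀ᶠ j in U, ∀ e ∈ ((Subtype.val : E → _) '' (sphere (0 : E) 1)), ∀ t : ℝ,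
      1 ≤ q * ‖e + t • (Jm X (b j) - H)‖ := by
    refine hK.induction_on (p := fun S => ∀ᶠ j in U, ∀ e ∈ S, ∀ t : ℝ,
      1 ≤ q * ‖e + t • (Jm X (b j) - H)‖) (by simp) ?_ ?_ ?_
    · intro S T hST hT
      filter_upwards [hT] with j hj e he using hj e (hST he)
    · intro S T hS hT
      filter_upwards [hS, hT] with j hj1 hj2 e he
      rcases he with he | he
      · exact hj1 e he
      · exact hj2 e he
    · rintro _ ⟨e, he, rfl⟩
      have hen : ‖(e : Bid X)‖ = 1 := by simpa using he
      set θ : ℝ := (1 - 1 / q) / 2 with hθ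
      have hq0 : 0 < q := by linarith
      have h1q : 1 / q < 1 := by rw [div_lt_one hq0]; exact hq
      have hθ0 : 0 < θ := by rw [hθ]; linarith
      have hqθ : q * (1 - 2 * θ) = 1 := by rw [hθ]; field_simp; ring
      obtain ⟨φ, hφ1, hφ⟩ : ∃ φ : StrongDual ℝ X, ‖φ‖ ≤ 1 ∧
          1 - θ < ev φ (e : Bid X) := by
        obtain ⟨φ, h1, h2⟩ := exists_ev (e : Bid X) (1 - θ) (by rw [hen]; linarith)
        rcases le_total 0 (ev φ (e : Bid X)) with h3 | h3
        · exact ⟨φ, h1.le, by rwa [abs_of_nonneg h3] at h2⟩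
        · exact ⟨-φ, by rw [norm_neg]; exact h1.le, by
            rw [abs_of_nonpos h3] at h2; rwa [ev_neg]⟩
      have hnb : {e' : Bid X | 1 - θ < ev φ e'} ∈
          𝓝 (e : Bid X) := by
        have hc : Continuous (fun e' : Bid X => ev φ e') :=
          (ev φ).continuous
        exact (isOpen_lt continuous_const hc).mem_nhds hφ
      refine ⟨_, inter_mem_nhdsWithin _ hnb, ?_⟩
      have hev : ∀ᶠ j in U, |φ (b j) - ev φ H| < θ * δ / 2 := by
        have := (Metric.tendsto_nhds.1 (hH φ)) (θ * δ / 2) (by positivity)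
        simpa [Real.dist_eq] using this
      filter_upwards [hev, hsep] with j hj1 hj2
      rintro e' ⟨⟨e'', he'', rfl⟩, hm⟩ t
      have hen' : ‖(e'' : Bid X)‖ = 1 := by simpa using he''
      set f := (e'' : Bid X)
      set z := Jm X (b j) - H with hz
      by_cases ht : 2 / δ ≤ |t|
      · have h1 : ‖t • z‖ ≤ ‖f + t • z‖ + ‖f‖ := by
          calc ‖t • z‖ = ‖(f + t • z) - f‖ := by congr 1; abel
            _ ≤ _ := norm_sub_le _ _
        rw [norm_smul, Real.norm_eq_abs, hen'] at h1
        have h2 : 2 ≤ |t| * ‖z‖ := by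
          calc (2 : ℝ) = 2 / δ * δ := by field_simp
            _ ≤ |t| * ‖z‖ := by gcongr
        nlinarith
      · push Not at ht
        have h1 : ev φ (f + t • z) ≤ ‖f + t • z‖ := by
          calc ev φ (f + t • z) ≤ |ev φ (f + t • z)| := le_abs_self _
            _ ≤ ‖f + t • z‖ * ‖φ‖ := ev_le _ _
            _ ≤ ‖f + t • z‖ * 1 := by gcongr
            _ = _ := mul_one _
        have h2 : ev φ (f + t • z) = ev φ f + t * (φ (b j) - ev φ H) := by
          rw [map_add, map_smul, hz, map_sub, ev_Jm, smul_eq_mul]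
        have h3 : |t * (φ (b j) - ev φ H)| ≤ θ := by
          rw [abs_mul]
          calc |t| * |φ (b j) - ev φ H| ≤ 2 / δ * (θ * δ / 2) := by gcongr
            _ = θ := by field_simp
        have h4 : 1 - 2 * θ ≤ ‖f + t • z‖ := by
          have h5 := (abs_le.1 h3).1
          have h6 : 1 - θ < ev φ f := hm
          linarith
        nlinarith
  filter_upwards [key] with j hj e he t
  rcases eq_or_ne e 0 with rfl | hne
  · simp only [norm_zero]
    have : 0 ≤ q := by linarith
    positivity
  · have hn : 0 < ‖e‖ := norm_pos_iff.2 hne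
    have := hj (‖e‖⁻¹ • e) ⟨⟨‖e‖⁻¹ • e, E.smul_mem _ he⟩, by
      simp [norm_smul, hn.ne'], rfl⟩ (‖e‖⁻¹ * t)
    rw [mul_smul, ← smul_add, norm_smul, norm_inv, norm_norm] at this
    have h2 := mul_le_mul_of_nonneg_left this hn.le
    calc ‖e‖ = ‖e‖ * 1 := (mul_one _).symm
      _ ≤ _ := h2
      _ = _ := by field_simp

/-- the chain property. -/
def Chain (κ : ℝ) (b : ℕ → X) (H : Bid X) : Prop :=
  ∀ (c : ℕ → ℝ) (k n : ℕ), k ≤ n →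
    ‖Jm X (∑ j ∈ Finset.range k, c j • b j) + (∑ j ∈ Finset.Ico k n, c j) • H‖ ≤
      κ * ‖∑ j ∈ Finset.range n, c j • b j‖

lemma exists_chain (U : Filter ℕ) [U.NeBot] (hU : U ≤ atTop) (b : ℕ → X)
    (H : Bid X)
    (hH : WLim U b H) (δ : ℝ) (hδ : 0 < δ) (hsep : ∀ᶠ j in U, δ ≤ ‖Jm X (b j) - H‖)
    (A : Set ℕ) (hA : A ∈ U) (η : ℝ) (hη : 0 < η) :
    ∃ s : ℕ → ℕ, StrictMono s ∧ (∀ j, s j ∈ A) ∧ Chain (1 + η) (b ∘ s) H := by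
  let τ : ℕ → ℝ := fun N => 1 + η / 2 ^ N
  have hτ1 : ∀ N, 1 ≤ τ N := fun N => by
    have : 0 ≤ η / 2 ^ N := by positivity
    simp only [τ]; linarith
  have hτs : ∀ N, τ (N + 1) < τ N := fun N => by
    simp only [τ]
    have : 0 < η / 2 ^ N := by positivity
    rw [pow_succ, ← div_div]; linarith
  have hτa : Antitone τ := antitone_nat_of_succ_le fun N => (hτs N).le
  let E : ℕ → Submodule ℝ (Bid X) := fun N =>
    Submodule.span ℝ (insert H ((fun i => Jm X (b i)) '' (Set.Iio N)))
  have hEfin : ∀ N, FiniteDimensional ℝ (E N) := fun N =>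
    FiniteDimensional.span_of_finite ℝ (((Set.finite_Iio N).image _).insert H)
  have hex : ∀ N, ∃ j, N ≤ j ∧ j ∈ A ∧ ∀ e ∈ E N, ∀ t : ℝ,
      ‖e‖ ≤ (τ N / τ (N + 1)) * ‖e + t • (Jm X (b j) - H)‖ := by
    intro N
    have := hEfin N
    have h1 := mazur_step U b H hH δ hδ hsep (E N) (τ N / τ (N + 1)) (by
      rw [one_lt_div (by linarith [hτ1 (N + 1)])]; exact hτs N)
    obtain ⟨j, h2, h3, h4⟩ := (h1.and ((show ∀ᶠ j in U, N ≤ j from hU (eventually_ge_atTop N)).and hA)).exists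
    exact ⟨j, h3, h4, h2⟩
  choose g hg1 hg2 hg3 using hex
  let Nn : ℕ → ℕ := fun k => Nat.rec 0 (fun _ N => g N + 1) k
  have hNs : ∀ k, Nn (k + 1) = g (Nn k) + 1 := fun k => rfl
  have hNlt : ∀ k, Nn k < Nn (k + 1) := fun k => by
    rw [hNs]; exact Nat.lt_succ_of_le (hg1 _)
  have hNm : StrictMono Nn := strictMono_nat_of_lt_succ hNlt
  let s : ℕ → ℕ := fun k => g (Nn k)
  have hsN : ∀ i k, i < k → s i < Nn k := fun i k hik => by
    have : Nn (i + 1) ≤ Nn k := hNm.monotone hik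
    rw [hNs] at this
    exact this
  refine ⟨s, strictMono_nat_of_lt_succ fun k => ?_, fun j => hg2 _, ?_⟩
  · exact lt_of_lt_of_le (hsN k (k + 1) (Nat.lt_succ_self k)) (hg1 _)
  intro c k n hkn
  let V : ℕ → Bid X := fun k =>
    Jm X (∑ j ∈ Finset.range k, c j • (b ∘ s) j) + (∑ j ∈ Finset.Ico k n, c j) • H
  have hVE : ∀ k, V k ∈ E (Nn k) := by
    intro k
    refine Submodule.add_mem _ ?_ (Submodule.smul_mem _ _ (Submodule.subset_span (by simp)))
    rw [map_sum]
    refine Submodule.sum_mem _ fun i hi => ?_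
    rw [map_smul]
    refine Submodule.smul_mem _ _ (Submodule.subset_span ?_)
    right
    exact ⟨s i, hsN i k (Finset.mem_range.1 hi), rfl⟩
  have hstep : ∀ k, k < n → ‖V k‖ / τ (Nn k) ≤ ‖V (k + 1)‖ / τ (Nn (k + 1)) := by
    intro k hk
    have h1 := hg3 (Nn k) (V k) (hVE k) (c k)
    have h2 : V k + c k • (Jm X (b (g (Nn k))) - H) = V (k + 1) := by
      simp only [V]
      rw [Finset.sum_range_succ, map_add, map_smul, Finset.sum_eq_sum_Ico_succ_bot hk, add_smul,
        smul_sub]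
      simp only [Function.comp, s]
      abel
    rw [h2] at h1
    have p1 : 0 < τ (Nn k) := by linarith [hτ1 (Nn k)]
    have p2 : 0 < τ (Nn (k + 1)) := by linarith [hτ1 (Nn (k + 1))]
    have p3 : 0 < τ (Nn k + 1) := by linarith [hτ1 (Nn k + 1)]
    have h3 : τ (Nn (k + 1)) ≤ τ (Nn k + 1) := hτa (hNlt k)
    calc ‖V k‖ / τ (Nn k) ≤ (τ (Nn k) / τ (Nn k + 1) * ‖V (k + 1)‖) / τ (Nn k) := by gcongr
      _ = ‖V (k + 1)‖ / τ (Nn k + 1) := by field_simp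
      _ ≤ _ := by gcongr
  have hall : ∀ m, k ≤ m → m ≤ n → ‖V k‖ / τ (Nn k) ≤ ‖V m‖ / τ (Nn m) := by
    intro m hm
    induction m, hm using Nat.le_induction with
    | base => intro _; exact le_rfl
    | succ m hm ih => intro h; exact (ih (by omega)).trans (hstep m (by omega))
  have hfin := hall n hkn le_rfl
  have hVn : ‖V n‖ = ‖∑ j ∈ Finset.range n, c j • (b ∘ s) j‖ := by
    simp only [V, Finset.Ico_self, Finset.sum_empty, zero_smul, add_zero]
    exact (Jm X).norm_map _
  have p1 : 0 < τ (Nn k) := by linarith [hτ1 (Nn k)]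
  have h0 : τ (Nn k) ≤ 1 + η := by
    have := hτa (Nat.zero_le (Nn k))
    simpa [τ] using this
  calc ‖V k‖ = τ (Nn k) * (‖V k‖ / τ (Nn k)) := by field_simp
    _ ≤ τ (Nn k) * (‖V n‖ / τ (Nn n)) := by gcongr
    _ ≤ (1 + η) * (‖V n‖ / 1) := by
      gcongr
      exact hτ1 _
    _ = _ := by rw [div_one, hVn]

/-- finitely supported convex coefficients supported in `A` -/
def CS (A : Set ℕ) : Set (ℕ →₀ ℝ) :=
  {a | (∀ i, 0 ≤ a i) ∧ Finsupp.linearCombination ℝ (fun _ : ℕ => (1 : ℝ)) a = 1 ∧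
    ∀ i, i ∉ A → a i = 0}

lemma CS_mono {A B : Set ℕ} (h : A ⊆ B) : CS A ⊆ CS B :=
  fun _ ha => ⟨ha.1, ha.2.1, fun i hi => ha.2.2 i fun h' => hi (h h')⟩

lemma convex_CS (A : Set ℕ) : Convex ℝ (CS A) := by
  intro a ha b hb p q hp hq hpq
  refine ⟨fun i => ?_, ?_, fun i hi => ?_⟩
  · have := ha.1 i
    have := hb.1 i
    simp only [Finsupp.add_apply, Finsupp.smul_apply, smul_eq_mul]
    positivity
  · rw [map_add, map_smul, map_smul, ha.2.1, hb.2.1]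
    simpa using hpq
  · simp [ha.2.2 i hi, hb.2.2 i hi]

lemma single_mem_CS {A : Set ℕ} {j : ℕ} (hj : j ∈ A) : Finsupp.single j (1 : ℝ) ∈ CS A := by
  refine ⟨fun i => ?_, by simp, fun i hi => ?_⟩
  · rw [Finsupp.single_apply]; split_ifs <;> norm_num
  · rw [Finsupp.single_apply, if_neg]
    rintro rfl
    exact hi hj

lemma lc_eq_sum {V : Type*} [AddCommGroup V] [Module ℝ V] (v : ℕ → V) (a : ℕ →₀ ℝ) (S : Finset ℕ)
    (h : ∀ i, i ∉ S → a i = 0) :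
    Finsupp.linearCombination ℝ v a = ∑ i ∈ S, a i • v i := by
  rw [Finsupp.linearCombination_apply]
  refine Finsupp.sum_of_support_subset a ?_ _ (by simp)
  intro i hi
  by_contra hc
  exact (Finsupp.mem_support_iff.1 hi) (h i hc)

lemma exists_bound (a : ℕ →₀ ℝ) : ∃ n, ∀ i, n ≤ i → a i = 0 := by
  refine ⟨a.support.sup id + 1, fun i hi => ?_⟩
  by_contra hc
  have := Finset.le_sup (f := id) (Finsupp.mem_support_iff.2 hc)
  simp only [id] at this
  omega

/-- tails of `x` along `A` have convex combinations within `r` of `y` -/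
def QQ (x : ℕ → X) (y : X) (r : ℝ) (A : Set ℕ) : Prop :=
  ∀ m : ℕ, ∃ a ∈ CS (A ∩ Set.Ici m), ‖Finsupp.linearCombination ℝ x a - y‖ < r

lemma QQ_mono (x : ℕ → X) (y : X) (r : ℝ) (A B : Set ℕ) (h : (A \ B).Finite)
    (hA : QQ x y r A) : QQ x y r B := by
  intro m
  obtain ⟨M, hM⟩ := h.bddAbove
  obtain ⟨a, ha, hr⟩ := hA (max m (M + 1))
  refine ⟨a, CS_mono ?_ ha, hr⟩
  rintro i ⟨hi1, hi2⟩
  have h2 : max m (M + 1) ≤ i := hi2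
  refine ⟨?_, le_trans (le_max_left _ _) h2⟩
  by_contra hc
  have := hM ⟨hi1, hc⟩
  have := le_trans (le_max_right m (M + 1)) h2
  omega

lemma QQ_of_wlim (U : Filter ℕ) [U.NeBot] (hU : U ≤ atTop) (x : ℕ → X) (G : Bid X)
    (hG : WLim U x G) (A : Set ℕ) (hA : A ∈ U) (y : X) (r : ℝ) (hr : ‖G - Jm X y‖ < r) :
    QQ x y r A := by
  intro m
  by_contra! hcon
  have hr0 : 0 < r := lt_of_le_of_lt (norm_nonneg _) hr
  have hm : A ∩ Set.Ici m ∈ U := inter_mem hA (hU (Ici_mem_atTop m))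
  obtain ⟨φ, u, h1, h2⟩ := geometric_hahn_banach_open (convex_ball y r) isOpen_ball
    ((convex_CS (A ∩ Set.Ici m)).linear_image (Finsupp.linearCombination ℝ x)) (by
      rw [Set.disjoint_left]
      rintro _ hz ⟨a, ha, rfl⟩
      rw [mem_ball, dist_eq_norm] at hz
      exact absurd hz (not_lt.2 (hcon a ha)))
  have h3 : u ≤ ev φ G := by
    refine ge_of_tendsto (hG φ) ?_
    filter_upwards [hm] with j hj
    have := h2 _ ⟨_, single_mem_CS hj, rfl⟩
    simpa using this
  have h4 : ev φ G - φ y ≤ ‖G - Jm X y‖ * ‖φ‖ := by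
    have := (le_abs_self _).trans (ev_le φ (G - Jm X y))
    rwa [map_sub, ev_Jm] at this
  have h5 : φ y < u := h1 y (mem_ball_self hr0)
  have h6 : 0 < u - φ y := by linarith
  have h7 : ‖φ‖ * r ≤ u - φ y := by
    by_contra! hc
    obtain ⟨z, hz1, hz2⟩ := ContinuousLinearMap.exists_lt_apply_of_lt_opNorm φ
      (r := (u - φ y) / r) (by rwa [div_lt_iff₀ hr0])
    rw [div_lt_iff₀ hr0, Real.norm_eq_abs] at hz2
    have hn : ‖r • z‖ < r := by
      rw [norm_smul, Real.norm_of_nonneg hr0.le]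
      nlinarith
    have q1 := h1 (y + r • z) (by simpa [mem_ball, dist_eq_norm] using hn)
    have q2 := h1 (y - r • z) (by simpa [mem_ball, dist_eq_norm] using hn)
    rw [map_add, map_smul, smul_eq_mul] at q1
    rw [map_sub, map_smul, smul_eq_mul] at q2
    rcases abs_cases (φ z) with ⟨h, _⟩ | ⟨h, _⟩ <;> rw [h] at hz2 <;> linarith
  have h8 : 0 < ‖φ‖ := by
    by_contra hc
    have : ‖φ‖ = 0 := le_antisymm (not_lt.1 hc) (norm_nonneg _)
    rw [this] at h4
    linarith
  nlinarith

lemma CS_comap (x : ℕ → X) (t : ℕ → ℕ) (ht : StrictMono t) (m : ℕ) (a : ℕ →₀ ℝ)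
    (ha : a ∈ CS (Set.range t ∩ Set.Ici (t m))) :
    ∃ a' ∈ CS (Set.Ici m),
      Finsupp.linearCombination ℝ (x ∘ t) a' = Finsupp.linearCombination ℝ x a := by
  let a' := Finsupp.comapDomain t a ht.injective.injOn
  have hmap : Finsupp.mapDomain t a' = a := by
    refine Finsupp.mapDomain_comapDomain t ht.injective a ?_
    intro i hi
    by_contra hc
    exact (Finsupp.mem_support_iff.1 hi) (ha.2.2 i fun h => hc h.1)
  refine ⟨a', ⟨fun i => ha.1 (t i), ?_, fun i hi => ?_⟩, ?_⟩
  · have h1 := ha.2.1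
    rw [← hmap, Finsupp.linearCombination_mapDomain] at h1
    exact h1
  · refine ha.2.2 (t i) fun h => hi ?_
    exact ht.le_iff_le.1 h.2
  · conv_rhs => rw [← hmap, Finsupp.linearCombination_mapDomain]

lemma stabilize (P : ℕ → Set ℕ → Prop)
    (hP : ∀ i A B, (A \ B).Finite → P i A → P i B) (A₀ : Set ℕ) (hA₀ : A₀.Infinite) :
    ∃ A ⊆ A₀, A.Infinite ∧ ∀ i, P i A → ∀ B ⊆ A, B.Infinite → P i B := by
  have step : ∀ (i : ℕ) (B : {B : Set ℕ // B.Infinite}), ∃ B' : {B : Set ℕ // B.Infinite},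
      B'.1 ⊆ B.1 ∧ (P i B'.1 → ∀ C ⊆ B'.1, C.Infinite → P i C) := by
    rintro i ⟨B, hB⟩
    by_cases h : ∃ C ⊆ B, C.Infinite ∧ ¬ P i C
    · obtain ⟨C, hCB, hC, hPC⟩ := h
      exact ⟨⟨C, hC⟩, hCB, fun h' => absurd h' hPC⟩
    · push Not at h
      exact ⟨⟨B, hB⟩, subset_rfl, fun _ => h⟩
  choose F hF1 hF2 using step
  let S : ℕ → {B : Set ℕ // B.Infinite} := fun n => Nat.rec ⟨A₀, hA₀⟩ (fun i B => F i B) n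
  have hS : ∀ n, S (n + 1) = F n (S n) := fun _ => rfl
  have hanti : Antitone (fun n => (S n).1) := antitone_nat_of_succ_le fun n => by
    simp only [hS]; exact hF1 n (S n)
  obtain ⟨d, hd, hdS⟩ := extraction_forall_of_frequently (P := fun n k => k ∈ (S n).1)
    (fun n => Nat.frequently_atTop_iff_infinite.2 (S n).2)
  have hfin : ∀ n, (Set.range d \ (S n).1).Finite := by
    intro n
    refine ((Set.finite_Iio n).image d).subset ?_
    rintro _ ⟨⟨k, rfl⟩, hk⟩
    refine ⟨k, ?_, rfl⟩
    by_contra hc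
    exact hk (hanti (not_lt.1 hc) (hdS k))
  refine ⟨Set.range d, ?_, Set.infinite_range_of_injective hd.injective, ?_⟩
  · rintro _ ⟨k, rfl⟩
    exact hanti (Nat.zero_le k) (hdS k)
  · intro i hi B hB hBi
    have h1 : P i (S (i + 1)).1 := hP i _ _ (hfin (i + 1)) hi
    have hBf : (B \ (S (i + 1)).1).Finite :=
      (hfin (i + 1)).subset (Set.sdiff_subset_sdiff_left hB)
    have h2 : (B ∩ (S (i + 1)).1).Infinite := by
      intro hc
      apply hBi
      rw [← Set.inter_union_sdiff B (S (i + 1)).1]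
      exact hc.union hBf
    have h3 := hF2 i (S i) h1 _ Set.inter_subset_right h2
    refine hP i _ _ ?_ h3
    rw [Set.sdiff_eq_empty.2 Set.inter_subset_left]
    exact Set.finite_empty

lemma dist_lower (Y : Submodule ℝ X) (G : Bid X) (ρ : ℝ) (hρ : ∀ y ∈ Y, ρ ≤ ‖G - Jm X y‖)
    (x₀ : X) (hx₀ : x₀ ∈ Y) (f : X) (hf : f ∈ Y) (t : ℝ) :
    |t| * ρ ≤ ‖Jm X f + t • (G - Jm X x₀)‖ := by
  rcases eq_or_ne t 0 with rfl | ht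
  · simp
  · have h1 := hρ (x₀ - t⁻¹ • f) (Y.sub_mem hx₀ (Y.smul_mem _ hf))
    have h2 : Jm X f + t • (G - Jm X x₀) = t • (G - Jm X (x₀ - t⁻¹ • f)) := by
      rw [map_sub, map_smul, smul_sub, smul_sub, smul_sub, smul_inv_smul₀ ht]
      abel
    rw [h2, norm_smul, Real.norm_eq_abs]
    gcongr

lemma chain_bounds (κ : ℝ) (β : ℕ → X) (H : Bid X) (hC : Chain κ β H)
    (Y : Submodule ℝ X) (hβ : ∀ j, β j ∈ Y) (ρ : ℝ)
    (hρ : ∀ f ∈ Y, ∀ t : ℝ, |t| * ρ ≤ ‖Jm X f + t • H‖) (c : ℕ → ℝ) (k n : ℕ) (hkn : k ≤ n) :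
    |∑ j ∈ Finset.Ico k n, c j| * ρ ≤ κ * ‖∑ j ∈ Finset.range n, c j • β j‖ ∧
    ∀ q : ℝ, 0 ≤ q → ‖H‖ ≤ q * ρ → ‖∑ j ∈ Finset.range k, c j • β j‖ ≤
      (1 + q) * (κ * ‖∑ j ∈ Finset.range n, c j • β j‖) := by
  have h1 := hC c k n hkn
  have h2 := hρ (∑ j ∈ Finset.range k, c j • β j)
    (Y.sum_mem fun j _ => Y.smul_mem _ (hβ j)) (∑ j ∈ Finset.Ico k n, c j)
  set f := ∑ j ∈ Finset.range k, c j • β j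
  set t := ∑ j ∈ Finset.Ico k n, c j
  refine ⟨h2.trans h1, fun q hq hH => ?_⟩
  have h3 : ‖f‖ ≤ ‖Jm X f + t • H‖ + |t| * ‖H‖ := by
    rw [← (Jm X).norm_map f]
    calc ‖Jm X f‖ = ‖(Jm X f + t • H) - t • H‖ := by congr 1; abel
      _ ≤ ‖Jm X f + t • H‖ + ‖t • H‖ := norm_sub_le _ _
      _ = _ := by rw [norm_smul, Real.norm_eq_abs]
  have h4 : |t| * ‖H‖ ≤ q * ‖Jm X f + t • H‖ := by
    calc |t| * ‖H‖ ≤ |t| * (q * ρ) := by gcongr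
      _ = q * (|t| * ρ) := by ring
      _ ≤ _ := by gcongr
  calc ‖f‖ ≤ (1 + q) * ‖Jm X f + t • H‖ := by linarith
    _ ≤ _ := by gcongr

lemma block_gen {V : Type*} [AddCommGroup V] [Module ℝ V] (N : ℕ → ℕ)
    (hN : StrictMono N) (α : ℕ → ℕ → ℝ)
    (hα : ∀ j i, i ∉ Finset.Ico (N j) (N (j + 1)) → α j i = 0) (c : ℕ → ℝ) (n : ℕ)
    (v w : ℕ → V) (hw : ∀ j, w j = ∑ i ∈ Finset.Ico (N j) (N (j + 1)), α j i • v i)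
    (k : ℕ) (hk : k ≤ n) :
    ∑ i ∈ Finset.range (N k), (∑ j ∈ Finset.range n, c j * α j i) • v i =
      ∑ j ∈ Finset.range k, c j • w j := by
  have hge : ∀ k j, k ≤ j → ∀ i ∈ Finset.range (N k), α j i = 0 := by
    intro k j hjk i hi
    apply hα
    have : N k ≤ N j := hN.monotone hjk
    simp only [Finset.mem_range, Finset.mem_Ico] at hi ⊢
    omega
  simp only [Finset.sum_smul]
  rw [Finset.sum_comm, ← Finset.sum_range_add_sum_Ico _ hk]
  have e1 : ∀ j ∈ Finset.range k, ∑ i ∈ Finset.range (N k), (c j * α j i) • v i = c j • w j := by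
    intro j hj
    rw [hw j, Finset.smul_sum]
    simp only [mul_smul]
    symm
    apply Finset.sum_subset
    · intro i hi
      have : N (j + 1) ≤ N k := hN.monotone (Finset.mem_range.1 hj)
      simp only [Finset.mem_range, Finset.mem_Ico] at hi ⊢
      omega
    · intro i _ hi
      rw [hα j i hi, zero_smul, smul_zero]
  have e2 : ∀ j ∈ Finset.Ico k n, ∑ i ∈ Finset.range (N k), (c j * α j i) • v i = 0 := by
    intro j hj
    apply Finset.sum_eq_zero
    intro i hi
    rw [hge k j (Finset.mem_Ico.1 hj).1 i hi, mul_zero, zero_smul]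
  rw [Finset.sum_congr rfl e1, Finset.sum_eq_zero e2, add_zero]

lemma chain_block (κ : ℝ) (β : ℕ → X) (H : Bid X) (hC : Chain κ β H) (N : ℕ → ℕ)
    (hN : StrictMono N) (α : ℕ → ℕ → ℝ)
    (hα : ∀ j i, i ∉ Finset.Ico (N j) (N (j + 1)) → α j i = 0)
    (hα1 : ∀ j, ∑ i ∈ Finset.Ico (N j) (N (j + 1)), α j i = 1)
    (u : ℕ → X) (hu : ∀ j, u j = ∑ i ∈ Finset.Ico (N j) (N (j + 1)), α j i • β i) :
    Chain κ u H := by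
  intro c k n hkn
  let γ : ℕ → ℝ := fun i => ∑ j ∈ Finset.range n, c j * α j i
  have g1 := block_gen N hN α hα c n β u hu
  have g2 : ∀ k ≤ n, ∑ i ∈ Finset.range (N k), γ i = ∑ j ∈ Finset.range k, c j := by
    intro k hk
    have := block_gen N hN α hα c n (fun _ => (1 : ℝ)) (fun _ => 1) (by simp [hα1]) k hk
    simpa [γ] using this
  have h := hC γ (N k) (N n) (hN.monotone hkn)
  have e1 : ∑ i ∈ Finset.range (N k), γ i • β i = _ := g1 k hkn
  have e2 : ∑ i ∈ Finset.range (N n), γ i • β i = _ := g1 n le_rfl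
  rw [e1, e2, Finset.sum_Ico_eq_sub _ (hN.monotone hkn), g2 k hkn, g2 n le_rfl,
    ← Finset.sum_Ico_eq_sub _ hkn] at h
  exact h

lemma exists_blocks (β : ℕ → X) (r : ℝ)
    (h : ∀ m, ∃ a ∈ CS (Set.Ici m), ‖Finsupp.linearCombination ℝ β a‖ < r) :
    ∃ (N : ℕ → ℕ) (α : ℕ → ℕ → ℝ) (u : ℕ → X), StrictMono N ∧ (∀ j i, 0 ≤ α j i) ∧
      (∀ j i, i ∉ Finset.Ico (N j) (N (j + 1)) → α j i = 0) ∧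
      (∀ j, ∑ i ∈ Finset.Ico (N j) (N (j + 1)), α j i = 1) ∧
      (∀ j, u j = ∑ i ∈ Finset.Ico (N j) (N (j + 1)), α j i • β i) ∧
      (∀ j, ‖u j‖ < r) := by
  have h' : ∀ m, ∃ a ∈ CS (Set.Ici m), ‖Finsupp.linearCombination ℝ β a‖ < r ∧
      ∃ n, m < n ∧ ∀ i, n ≤ i → a i = 0 := by
    intro m
    obtain ⟨a, ha, hr⟩ := h m
    obtain ⟨n, hn⟩ := exists_bound a
    exact ⟨a, ha, hr, max n (m + 1), by omega, fun i hi => hn i (by omega)⟩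
  choose a ha har n hmn hn using h'
  let N : ℕ → ℕ := fun j => Nat.rec 0 (fun _ m => n m) j
  have hNs : ∀ j, N (j + 1) = n (N j) := fun _ => rfl
  have hz : ∀ j i, i ∉ Finset.Ico (N j) (N (j + 1)) → a (N j) i = 0 := by
    intro j i hi
    rw [Finset.mem_Ico, not_and_or] at hi
    rcases hi with hi | hi
    · exact (ha (N j)).2.2 i hi
    · exact hn (N j) i (by rw [← hNs]; omega)
  refine ⟨N, fun j i => a (N j) i, fun j => Finsupp.linearCombination ℝ β (a (N j)),
    strictMono_nat_of_lt_succ fun j => by rw [hNs]; exact hmn _, fun j i => (ha _).1 i, hz,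
    fun j => ?_, fun j => ?_, fun j => har _⟩
  · have := (ha (N j)).2.1
    rw [lc_eq_sum _ _ _ (hz j)] at this
    simpa using this
  · exact lc_eq_sum _ _ _ (hz j)

lemma block_isConvexBlockBasis (β : ℕ → X) (N : ℕ → ℕ) (α : ℕ → ℕ → ℝ) (u : ℕ → X)
    (hN : StrictMono N) (h0 : ∀ j i, 0 ≤ α j i)
    (hα : ∀ j i, i ∉ Finset.Ico (N j) (N (j + 1)) → α j i = 0)
    (hα1 : ∀ j, ∑ i ∈ Finset.Ico (N j) (N (j + 1)), α j i = 1)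
    (hu : ∀ j, u j = ∑ i ∈ Finset.Ico (N j) (N (j + 1)), α j i • β i) :
    IsConvexBlockBasis u β := by
  have key : ∀ j, ∀ i ∈ Finset.Ico (N j) (N (j + 1)), ∑ l ∈ Finset.range (i + 1), α l i = α j i := by
    intro j i hi
    rw [Finset.mem_Ico] at hi
    apply Finset.sum_eq_single_of_mem
    · have := hN.le_apply (x := j)
      rw [Finset.mem_range]; omega
    · intro l _ hl
      apply hα
      rw [Finset.mem_Ico]
      rcases lt_or_gt_of_ne hl with h | h
      · have : N (l + 1) ≤ N j := hN.monotone h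
        omega
      · have : N (j + 1) ≤ N l := hN.monotone h
        omega
  refine ⟨N, fun i => ∑ l ∈ Finset.range (i + 1), α l i, hN,
    fun i => Finset.sum_nonneg fun l _ => h0 l i, fun j => ?_, fun j => ?_⟩
  · rw [← hα1 j]
    exact Finset.sum_congr rfl (key j)
  · rw [hu j]
    exact Finset.sum_congr rfl fun i hi => by simp only [key j i hi]

lemma case_one [CompleteSpace X] (x : ℕ → X)
    (hnc : ¬ IsCompact (closure (Set.range x))) (ε : ℝ) (hε : 0 < ε)
    (hw : RelWeaklyCompact (Set.range x)) :
    ∃ (x₀ : X) (s : ℕ → ℕ), StrictMono s ∧ IsBasicWith (1 + ε) (fun j => x (s j) - x₀) := by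
  obtain ⟨U, hU, hUn⟩ := exists_ultrafilter_not_conv x hnc
  obtain ⟨x₀, hx₀⟩ := wlim_of_relWeaklyCompact x hw U
  have hnt := hUn x₀
  rw [Metric.tendsto_nhds] at hnt
  push Not at hnt
  obtain ⟨δ, hδ, hd⟩ := hnt
  have hd' : ∀ᶠ j in (U : Filter ℕ), δ ≤ ‖x j - x₀‖ := by
    filter_upwards [hd] with j hj
    rw [← dist_eq_norm]
    exact hj
  obtain ⟨s, hs, -, hc⟩ := exists_chain (U : Filter ℕ) hU (fun j => x j - x₀) 0
    (fun φ => by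
      have := (hx₀ φ).sub_const (φ x₀)
      simpa [ev_Jm] using this) δ hδ (by
      filter_upwards [hd'] with j hj
      rw [sub_zero, (Jm X).norm_map]
      exact hj) Set.univ univ_mem ε hε
  refine ⟨x₀, s, hs, fun c k n hkn => ?_⟩
  have := hc c k n hkn
  rw [smul_zero, add_zero, (Jm X).norm_map] at this
  exact this

/-- hereditary failure of weak compactness -/
lemma not_QQ (x : ℕ → X) (s : ℕ → ℕ) (hs : StrictMono s) (G : Bid X) (hC : Chain 2 (x ∘ s) G)
    (d : ℝ) (hd : 0 < d) (hG : ∀ y, d ≤ ‖G - Jm X y‖) (y : X) :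
    ¬ QQ x y (d / 8) (Set.range s) := by
  intro hQ
  obtain ⟨a, ha, hay⟩ := hQ (s 0)
  obtain ⟨a₁, ha₁, hlc₁⟩ := CS_comap x s hs 0 a ha
  obtain ⟨M, hM⟩ := exists_bound a₁
  obtain ⟨b, hb, hby⟩ := hQ (s M)
  obtain ⟨b₁, hb₁, hlc₂⟩ := CS_comap x s hs M b hb
  obtain ⟨n₀, hn₀⟩ := exists_bound b₁
  let n := max n₀ M
  have hMn : M ≤ n := le_max_right _ _
  have h1 := (chain_bounds 2 (x ∘ s) G hC ⊤ (fun _ => trivial) d (fun f _ t => by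
    have := dist_lower ⊤ G d (fun y _ => hG y) 0 trivial f trivial t
    simpa using this) (fun i => (a₁ - b₁) i) M n hMn).1
  have e1 : ∑ j ∈ Finset.range n, (a₁ - b₁) j • (x ∘ s) j =
      Finsupp.linearCombination ℝ x a - Finsupp.linearCombination ℝ x b := by
    rw [← lc_eq_sum, map_sub, hlc₁, hlc₂]
    intro i hi
    rw [Finset.mem_range, not_lt] at hi
    simp [hM i (hMn.trans hi), hn₀ i ((le_max_left _ _).trans hi)]
  have e2 : ∑ j ∈ Finset.Ico M n, (a₁ - b₁) j = -1 := by
    have h3 : ∑ j ∈ Finset.Ico M n, b₁ j = 1 := by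
      have := hb₁.2.1
      rw [lc_eq_sum _ _ (Finset.Ico M n)] at this
      · simpa using this
      · intro i hi
        rw [Finset.mem_Ico, not_and_or] at hi
        rcases hi with hi | hi
        · exact hb₁.2.2 i hi
        · exact hn₀ i ((le_max_left _ _).trans (not_lt.1 hi))
    rw [← h3, ← Finset.sum_neg_distrib]
    refine Finset.sum_congr rfl fun i hi => ?_
    simp [hM i (Finset.mem_Ico.1 hi).1]
  rw [e1, e2] at h1
  have h4 : ‖Finsupp.linearCombination ℝ x a - Finsupp.linearCombination ℝ x b‖ ≤ d / 8 + d / 8 := by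
    calc _ = ‖(Finsupp.linearCombination ℝ x a - y) - (Finsupp.linearCombination ℝ x b - y)‖ := by
          congr 1; abel
      _ ≤ _ := (norm_sub_le _ _).trans (by linarith)
  norm_num at h1
  linarith

lemma exists_ultra (A : Set ℕ) (hA : A.Infinite) :
    ∃ U : Ultrafilter ℕ, (U : Filter ℕ) ≤ atTop ∧ A ∈ U := by
  have : (atTop ⊓ 𝓟 A).NeBot :=
    frequently_mem_iff_neBot.1 (Nat.frequently_atTop_iff_infinite.2 hA)
  refine ⟨Ultrafilter.of (atTop ⊓ 𝓟 A), (Ultrafilter.of_le _).trans inf_le_left, ?_⟩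
  exact (le_principal_iff.1 ((Ultrafilter.of_le (atTop ⊓ 𝓟 A)).trans inf_le_right))

lemma case_two [CompleteSpace X] (x : ℕ → X) (hx : Bornology.IsBounded (Set.range x))
    (ε : ℝ) (hε : 0 < ε) (hw : ¬ RelWeaklyCompact (Set.range x)) :
    ∃ (x₀ : X) (s : ℕ → ℕ), StrictMono s ∧
        IsBasicWith (2 + ε) (fun j => x (s j) - x₀) ∧
        ∃ u : ℕ → X, IsConvexBlockBasis u (fun j => x (s j) - x₀) ∧
          ∃ c : ℝ, 0 < c ∧ ∃ t : ℕ → ℕ, StrictMono t ∧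
            IsWideSWith (1 + ε) (fun j => c • u (t j)) := by
  -- Step 1: a hereditarily non weakly compact subsequence
  obtain ⟨V, G₀, hG₀, hG₀n⟩ : ∃ V : Ultrafilter ℕ, ∃ G, WLim (V : Filter ℕ) x G ∧
      ∀ y, Jm X y ≠ G := by
    by_contra! hcon
    exact hw (relWeaklyCompact_of x hx fun U G h => hcon U G h)
  have hV : (V : Filter ℕ) ≤ atTop := by
    apply ultrafilter_le_atTop_of
    rintro n rfl
    obtain ⟨φ, hφ⟩ : ∃ φ : StrongDual ℝ X, ev φ (Jm X (x n) - G₀) ≠ 0 := by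
      obtain ⟨φ, -, h⟩ := exists_ev (Jm X (x n) - G₀) 0
        (norm_pos_iff.2 (sub_ne_zero.2 (hG₀n _)))
      exact ⟨φ, abs_pos.1 h⟩
    have h1 := hG₀ φ
    have h2 : Tendsto (fun j => φ (x j)) ((pure n : Ultrafilter ℕ) : Filter ℕ) (𝓝 (φ (x n))) :=
      tendsto_pure_nhds (fun j => φ (x j)) n
    have h3 := tendsto_nhds_unique h1 h2
    rw [map_sub, ev_Jm, h3, sub_self] at hφ
    exact hφ rfl
  obtain ⟨d, hd, hdG⟩ : ∃ d : ℝ, 0 < d ∧ ∀ y, d ≤ ‖G₀ - Jm X y‖ := by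
    have hcl : IsClosed (Set.range (Jm X)) := (Jm X).isometry.isClosedEmbedding.isClosed_range
    refine ⟨infDist G₀ (Set.range (Jm X)), ?_, fun y => ?_⟩
    · rw [← hcl.notMem_iff_infDist_pos ⟨_, 0, rfl⟩]
      rintro ⟨y, hy⟩
      exact hG₀n y hy
    · rw [← dist_eq_norm]
      exact infDist_le_dist_of_mem ⟨y, rfl⟩
  obtain ⟨s₀, hs₀, -, hC₀⟩ := exists_chain (V : Filter ℕ) hV x G₀ hG₀ d hd
    (Eventually.of_forall fun j => by rw [norm_sub_rev]; exact hdG _) Set.univ univ_mem 1 one_pos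
  rw [one_add_one_eq_two] at hC₀
  have hher := not_QQ x s₀ hs₀ G₀ hC₀ d hd hdG
  -- Step 2: stabilization
  let Y : Submodule ℝ X := Submodule.span ℝ (Set.range x)
  have hxY : ∀ j, x j ∈ Y := fun j => Submodule.subset_span ⟨j, rfl⟩
  have hsepY : TopologicalSpace.IsSeparable (Y : Set X) :=
    (Set.countable_range x).isSeparable.span
  have : TopologicalSpace.SeparableSpace Y := hsepY.separableSpace
  obtain ⟨e, he⟩ := exists_surjective_nat (ℕ × ℚ)
  let D : ℕ → Y := TopologicalSpace.denseSeq Y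
  obtain ⟨A, hAs, hAi, hA⟩ := stabilize
    (fun i B => QQ x (D (e i).1 : X) ((e i).2 : ℝ) B)
    (fun i B C h => QQ_mono x _ _ B C h) (Set.range s₀)
    (Set.infinite_range_of_injective hs₀.injective)
  obtain ⟨U, hU, hAU⟩ := exists_ultra A hAi
  obtain ⟨G, hG⟩ := exists_wlim U x hx
  have hGd : ∀ y, d / 8 ≤ ‖G - Jm X y‖ := by
    intro y
    by_contra! hc
    have h1 := QQ_of_wlim (U : Filter ℕ) hU x G hG A hAU y (d / 8) hc
    refine hher y (QQ_mono x y _ A _ ?_ h1)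
    rw [Set.sdiff_eq_empty.2 hAs]
    exact Set.finite_empty
  obtain ⟨η, hη, hη1, hηε⟩ : ∃ η : ℝ, 0 < η ∧ η ≤ 1 ∧ 4 * η ≤ ε :=
    ⟨min 1 (ε / 4), by positivity, min_le_left _ _, by
      have := min_le_right 1 (ε / 4); linarith⟩
  let T : Set (Bid X) := Jm X '' (Y : Set X)
  have hTne : T.Nonempty := ⟨_, 0, Y.zero_mem, rfl⟩
  set ρ := infDist G T with hρdef
  have hρle : ∀ y ∈ Y, ρ ≤ ‖G - Jm X y‖ := fun y hy => by
    rw [← dist_eq_norm]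
    exact infDist_le_dist_of_mem ⟨y, hy, rfl⟩
  have hρ0 : 0 < ρ := by
    refine lt_of_lt_of_le (by positivity : 0 < d / 8) ?_
    rw [hρdef, le_infDist hTne]
    rintro _ ⟨y, -, rfl⟩
    rw [dist_eq_norm]
    exact hGd y
  obtain ⟨i₀, hi₀⟩ : ∃ i, ‖G - Jm X (D i : X)‖ < (1 + η) * ρ := by
    have h1 : infDist G T < (1 + η) * ρ := by rw [← hρdef]; nlinarith
    obtain ⟨_, ⟨y, hy, rfl⟩, hyd⟩ := (infDist_lt_iff hTne).1 h1
    rw [dist_eq_norm] at hyd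
    have hop : IsOpen {z : Y | ‖G - Jm X (z : X)‖ < (1 + η) * ρ} := by
      refine isOpen_lt ?_ continuous_const
      exact (continuous_const.sub ((Jm X).continuous.comp continuous_subtype_val)).norm
    obtain ⟨i, hi⟩ := (TopologicalSpace.denseRange_denseSeq Y).exists_mem_open hop ⟨⟨y, hy⟩, hyd⟩
    exact ⟨i, hi⟩
  obtain ⟨r, hr1, hr2⟩ := exists_rat_btwn hi₀
  obtain ⟨i, hi⟩ := he (i₀, r)
  let x₀ : X := D i₀
  have hx₀Y : x₀ ∈ Y := (D i₀).2
  have hQA : QQ x x₀ r A := QQ_of_wlim (U : Filter ℕ) hU x G hG A hAU x₀ r hr1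
  have hQsub : ∀ B ⊆ A, B.Infinite → QQ x x₀ r B := by
    intro B hB hBi
    have := hA i (by rw [hi]; exact hQA) B hB hBi
    rw [hi] at this
    exact this
  -- Step 3: the chain
  let H : Bid X := G - Jm X x₀
  obtain ⟨s, hs, hsA, hC⟩ := exists_chain (U : Filter ℕ) hU (fun j => x j - x₀) H
    (fun φ => by
      have := (hG φ).sub_const (φ x₀)
      simpa [H, ev_Jm] using this) ρ hρ0 (Eventually.of_forall fun j => by
      have h1 : Jm X (x j - x₀) - H = -(G - Jm X (x j)) := by
        simp only [H, map_sub]; abel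
      rw [h1, norm_neg]
      exact hρle _ (hxY j)) A hAU η hη
  let β : ℕ → X := fun j => x (s j) - x₀
  have hC' : Chain (1 + η) β H := hC
  have hβY : ∀ j, β j ∈ Y := fun j => Y.sub_mem (hxY _) hx₀Y
  have hlow : ∀ f ∈ Y, ∀ t : ℝ, |t| * ρ ≤ ‖Jm X f + t • H‖ := fun f hf t =>
    dist_lower Y G ρ hρle x₀ hx₀Y f hf t
  have hHn : ‖H‖ ≤ (1 + η) * ρ := hi₀.le
  have hbas : ∀ v : ℕ → X, Chain (1 + η) v H → (∀ j, v j ∈ Y) → IsBasicWith (2 + ε) v := by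
    intro v hv hvY c k n hkn
    have := (chain_bounds (1 + η) v H hv Y hvY ρ hlow c k n hkn).2 (1 + η) (by linarith) hHn
    refine this.trans ?_
    rw [← mul_assoc]
    gcongr
    nlinarith
  -- Step 4: blocks
  have hblk : ∀ m, ∃ a ∈ CS (Set.Ici m), ‖Finsupp.linearCombination ℝ β a‖ < r := by
    intro m
    obtain ⟨a, ha, har⟩ := hQsub (Set.range s) (by rintro _ ⟨j, rfl⟩; exact hsA j)
      (Set.infinite_range_of_injective hs.injective) (s m)
    obtain ⟨a', ha', hlc⟩ := CS_comap x s hs m a ha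
    refine ⟨a', ha', ?_⟩
    obtain ⟨n, hn⟩ := exists_bound a'
    have hz : ∀ i, i ∉ Finset.range n → a' i = 0 := fun i hi =>
      hn i (not_lt.1 fun h => hi (Finset.mem_range.2 h))
    have h1 := ha'.2.1
    rw [lc_eq_sum _ _ _ hz] at h1
    have h2 : ∑ i ∈ Finset.range n, a' i = 1 := by simpa using h1
    have h3 : Finsupp.linearCombination ℝ β a' = Finsupp.linearCombination ℝ x a - x₀ := by
      rw [← hlc, lc_eq_sum _ _ _ hz, lc_eq_sum _ _ _ hz]
      simp only [β, smul_sub, Finset.sum_sub_distrib, ← Finset.sum_smul, h2, one_smul,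
        Function.comp]
    rw [h3]
    exact har
  obtain ⟨N, α, u, hN, h0, hα, hα1, hu, hur⟩ := exists_blocks β r hblk
  have hCu : Chain (1 + η) u H := chain_block (1 + η) β H hC' N hN α hα hα1 u hu
  have huY : ∀ j, u j ∈ Y := fun j => by
    rw [hu j]
    exact Y.sum_mem fun i _ => Y.smul_mem _ (hβY i)
  refine ⟨x₀, s, hs, hbas β hC' hβY, u,
    block_isConvexBlockBasis β N α u hN h0 hα hα1 hu, ρ⁻¹, inv_pos.2 hρ0, id, strictMono_id,
    ?_, ?_, ?_⟩
  · intro c k n hkn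
    have := hbas u hCu huY (fun j => c j * ρ⁻¹) k n hkn
    simp only [id, smul_smul]
    refine this.trans ?_
    gcongr
    linarith
  · intro j
    show ‖ρ⁻¹ • u j‖ ≤ 1 + ε
    rw [norm_smul, norm_inv, Real.norm_of_nonneg hρ0.le, inv_mul_le_iff₀ hρ0]
    have := hur j
    nlinarith
  · intro c k n hkn
    have h1 := (chain_bounds (1 + η) u H hCu Y huY ρ hlow c k n hkn).1
    have h2 : ∑ j ∈ Finset.range n, c j • ρ⁻¹ • u (id j) =
        ρ⁻¹ • ∑ j ∈ Finset.range n, c j • u j := by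
      rw [Finset.smul_sum]
      exact Finset.sum_congr rfl fun j _ => smul_comm _ _ _
    rw [h2, norm_smul, norm_inv, Real.norm_of_nonneg hρ0.le]
    rw [← le_div_iff₀ hρ0] at h1
    refine h1.trans ?_
    rw [div_eq_inv_mul, mul_left_comm]
    gcongr
    linarith

/-- given a bounded, not relatively (norm-)compact sequence `(x j)` and
`ε > 0`, there are `x ∈ X` and a subsequence `(x'_j)` such that with `b j = x'_j - x`:
(1) if `{x_1, x_2, …}` is relatively weakly compact then `(b j)` is `(1+ε)`-basic;
(2) otherwise `(b j)` is `(2+ε)`-basic and some positive multiple of a convex block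
basis of `(b j)` has a `(1+ε)`-wide-(s) subsequence. -/
theorem stmt_12 [CompleteSpace X] (x : ℕ → X) (hx : Bornology.IsBounded (Set.range x))
    (hnc : ¬ IsCompact (closure (Set.range x))) (ε : ℝ) (hε : 0 < ε) :
    ∃ (x₀ : X) (s : ℕ → ℕ), StrictMono s ∧
      (RelWeaklyCompact (Set.range x) →
        IsBasicWith (1 + ε) (fun j => x (s j) - x₀)) ∧
      (¬ RelWeaklyCompact (Set.range x) →
        IsBasicWith (2 + ε) (fun j => x (s j) - x₀) ∧
        ∃ u : ℕ → X, IsConvexBlockBasis u (fun j => x (s j) - x₀) ∧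
          ∃ c : ℝ, 0 < c ∧ ∃ t : ℕ → ℕ, StrictMono t ∧
            IsWideSWith (1 + ε) (fun j => c • u (t j))) := by
  by_cases hw : RelWeaklyCompact (Set.range x)
  · obtain ⟨x₀, s, hs, hb⟩ := case_one x hnc ε hε hw
    exact ⟨x₀, s, hs, fun _ => hb, fun h => absurd hw h⟩
  · obtain ⟨x₀, s, hs, hb⟩ := case_two x hx ε hε hw
    exact ⟨x₀, s, hs, fun h => absurd h hw, fun _ => hb⟩
end
end
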